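/- arXiv:2407.03530 — 2 statements merged into one kernel-verified Lean document; each statement's English description precedes it below -/
import Mathlib

section
/- For every real number x with 0 < x ≤ 10^8, one has Σ_{p ≤ x} (log p)/p − (log x + E) > 0, where the sum runs over primes p ≤ x and E = −γ − Σ_p (log p)/(p(p−1)), the latter sum running over all primes. -/
/-- The Mertens constant `E = −γ − Σ_p (log p)/(p(p−1))`, the sum running over all
primes. -/
noncomputable def mertensE : ℝ :=
  -Real.eulerMascheroniConstant -
    ∑' p : Nat.Primes, Real.log (p : ℕ) / (((p : ℕ) : ℝ) * (((p : ℕ) : ℝ) - 1))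

/-- The error term in Mertens's first theorem,
`Δ(x) = Σ_{p ≤ x} (log p)/p − (log x + E)`. -/
noncomputable def mertensDelta (x : ℝ) : ℝ :=
  (∑ p ∈ (Finset.range (⌊x⌋₊ + 1)).filter Nat.Prime, Real.log p / (p : ℝ)) -
    (Real.log x + mertensE)

namespace Mertens

/-! ### A bit sieve that the kernel can run

Everything in this section is written with raw recursors and the `Nat` operations which the kernel
evaluates with big integer arithmetic, so that `decide +kernel` can sieve millions of integers. -/

/-- Apply `k` to `n`; in the kernel `n` is evaluated to a numeral first. -/
def force {α : Type} (n : ℕ) (k : ℕ → α) : α :=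
  Nat.rec (k 0) (fun m _ => k m) (Nat.add n 1)

theorem force_eq {α : Type} (n : ℕ) (k : ℕ → α) : force n k = k n := rfl

/-- The product of the primes up to `181`. -/
def primorial181 : ℕ :=
  5397346292805549782720214077673687806275517530364350655459511599582614290

/-- A test passed by all primes `p ≥ 7`, and by few other odd numbers. -/
def isSieving (p : ℕ) : Bool :=
  Nat.beq (Nat.gcd p (Bool.rec primorial181 30 (Nat.ble p 181))) 1

/-- Concatenate `2 ^ j` copies of the `l`-bit word `m`. -/
def replicateBits (j : ℕ) : ℕ → ℕ → ℕ :=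
  Nat.rec (fun m _ => m)
    (fun _ ih m l => ih (Nat.lor m (Nat.shiftLeft m l)) (Nat.mul 2 l)) j

/-- Concatenate `n + 1` copies of the `l`-bit word `m`, where `j = log₂ n`. -/
def extend (m l j n : ℕ) : ℕ :=
  (fun r => Nat.lor r (Nat.shiftLeft r (Nat.mul l (Nat.sub (Nat.add n 1) (Nat.pow 2 j)))))
    (replicateBits j m l)

/-- The bit of the multiple `p * q` of `p` in a word of `8 * p` bits, rotated by `c`. -/
def patternBit (p c q : ℕ) : ℕ :=
  Nat.shiftLeft 1 (Nat.mod (Nat.add c (Nat.div (Nat.mul (Nat.mul 4 p) q) 15)) (Nat.mul 8 p))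

/-- The multiples of `p` coprime to `30` in a period of `30 * p`, rotated by `c` bits. -/
def pattern (p c : ℕ) : ℕ :=
  Nat.lor
    (Nat.lor (Nat.lor (patternBit p c 1) (patternBit p c 7))
      (Nat.lor (patternBit p c 11) (patternBit p c 13)))
    (Nat.lor (Nat.lor (patternBit p c 17) (patternBit p c 19))
      (Nat.lor (patternBit p c 23) (patternBit p c 29)))

/-- The multiples of `p` among the integers coprime to `30` in `[30 k₀, 30 (k₀ + s))`, the integer
`n` being represented by the bit `4 * n / 15 - 8 * k₀`. -/
def mask (k₀ s p : ℕ) : ℕ :=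
  force (Nat.div s p) fun n =>
    extend (pattern p (Nat.mul 8 (Nat.sub p (Nat.mod k₀ p)))) (Nat.mul 8 p) (Nat.log2 n) n

/-- The union of the masks of the sieving numbers up to `2 * r + 1`. -/
def composites (k₀ s r : ℕ) : ℕ → ℕ :=
  Nat.rec (fun acc => acc)
    (fun i ih acc => force (Nat.add (Nat.mul 2 i) 3) fun p =>
      Bool.rec (ih acc) (force (Nat.lor acc (mask k₀ s p)) ih) (isSieving p)) r

/-- The integer represented by the bit `i`. -/
def residue (i : ℕ) : ℕ :=
  Nat.add (Nat.mul 30 (Nat.div i 8))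
    (Nat.mod (Nat.div 0x1d1713110d0b0701 (Nat.pow 256 (Nat.mod i 8))) 256)

theorem residue_eq (i : ℕ) :
    residue i = 30 * (i / 8) + 0x1d1713110d0b0701 / 256 ^ (i % 8) % 256 := rfl

theorem residue_spec (i : ℕ) :
    4 * residue i / 15 = i ∧ residue i < 30 * (i / 8 + 1) ∧ 30 * (i / 8) ≤ residue i ∧
      Nat.Coprime (residue i) 30 := by
  have key : ∀ j < 8, 4 * (0x1d1713110d0b0701 / 256 ^ j % 256) / 15 = j ∧
      0x1d1713110d0b0701 / 256 ^ j % 256 < 30 ∧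
      Nat.Coprime (0x1d1713110d0b0701 / 256 ^ j % 256) 30 := by decide
  obtain ⟨h1, h2, h3⟩ := key (i % 8) (Nat.mod_lt _ (by norm_num))
  rw [residue_eq]
  generalize 0x1d1713110d0b0701 / 256 ^ (i % 8) % 256 = r at *
  refine ⟨by omega, by omega, by omega, ?_⟩
  rw [add_comm]
  simpa using h3

theorem residue_injective : Function.Injective residue := by
  intro i j h
  rw [← (residue_spec i).1, ← (residue_spec j).1, h]

theorem residue_add (k i : ℕ) : residue (8 * k + i) = 30 * k + residue i := by
  rw [residue_eq, residue_eq, Nat.mul_add_mod]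
  have : (8 * k + i) / 8 = k + i / 8 := by omega
  rw [this]
  ring

theorem replicateBits_succ (j m l : ℕ) :
    replicateBits (j + 1) m l = replicateBits j (m ||| m <<< l) (2 * l) := rfl

theorem testBit_replicateBits (j : ℕ) : ∀ m l t : ℕ, t < l * 2 ^ j → m.testBit (t % l) = true →
    (replicateBits j m l).testBit t = true := by
  induction j with
  | zero =>
    intro m l t ht h
    rw [pow_zero, mul_one] at ht
    rwa [Nat.mod_eq_of_lt ht] at h
  | succ j ih =>
    intro m l t ht h
    rw [replicateBits_succ]
    refine ih _ _ t (by rw [pow_succ] at ht; linarith) ?_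
    rw [Nat.testBit_or, Nat.testBit_shiftLeft, Bool.or_eq_true, Bool.and_eq_true]
    have hl : 0 < l := by
      rcases Nat.eq_zero_or_pos l with h0 | h0
      · simp [h0] at ht
      · exact h0
    have h2 : t % (2 * l) % l = t % l := Nat.mod_mod_of_dvd _ (Dvd.intro_left 2 rfl)
    have h3 : t % (2 * l) < 2 * l := Nat.mod_lt _ (by omega)
    rcases lt_or_ge (t % (2 * l)) l with h4 | h4
    · left
      rwa [← Nat.mod_eq_of_lt h4, h2]
    · right
      refine ⟨by simpa using h4, ?_⟩
      have h5 : (t % (2 * l) - l) % l = t % l := by rw [← Nat.mod_eq_sub_mod h4, h2]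
      rw [Nat.mod_eq_of_lt (by omega)] at h5
      rwa [h5]

theorem replicateBits_eq (j : ℕ) : ∀ m l : ℕ, m < 2 ^ l →
    replicateBits j m l = m * ∑ i ∈ Finset.range (2 ^ j), 2 ^ (l * i) := by
  induction j with
  | zero => intro m l _; simp [replicateBits]
  | succ j ih =>
    intro m l hm
    have h : m ||| m <<< l = m * (1 + 2 ^ l) := by
      rw [Nat.or_comm, ← Nat.shiftLeft_add_eq_or_of_lt hm, Nat.shiftLeft_eq]
      ring
    rw [replicateBits_succ, h, ih]
    · rw [pow_succ, mul_assoc]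
      congr 1
      clear ih
      generalize 2 ^ j = n
      induction n with
      | zero => simp
      | succ n ihn =>
        rw [Finset.sum_range_succ, mul_add, ihn, show (n + 1) * 2 = n * 2 + 1 + 1 by ring,
          Finset.sum_range_succ, Finset.sum_range_succ]
        ring
    · rw [two_mul, pow_add]
      nlinarith

theorem testBit_extend (m l n t : ℕ) (ht : t < l * (n + 1)) (h : m.testBit (t % l) = true) :
    (extend m l (Nat.log2 n) n).testBit t = true := by
  change (replicateBits (Nat.log2 n) m l |||
    replicateBits (Nat.log2 n) m l <<< (l * (n + 1 - 2 ^ Nat.log2 n))).testBit t = true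
  rw [Nat.testBit_or, Nat.testBit_shiftLeft, Bool.or_eq_true, Bool.and_eq_true]
  rcases lt_or_ge t (l * 2 ^ Nat.log2 n) with h1 | h1
  · exact Or.inl (testBit_replicateBits _ _ _ _ h1 h)
  · right
    have h2 : n < 2 ^ (Nat.log2 n + 1) := Nat.lt_log2_self
    obtain ⟨f, hf⟩ : ∃ f, f = n + 1 - 2 ^ Nat.log2 n := ⟨_, rfl⟩
    have h3 : f ≤ 2 ^ Nat.log2 n := by rw [pow_succ] at h2; omega
    have h4 : l * f ≤ t := (Nat.mul_le_mul_left l h3).trans h1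
    rw [← hf]
    refine ⟨by simpa using h4, testBit_replicateBits _ _ _ _ ?_ ?_⟩
    · have h5 : n + 1 ≤ f + 2 ^ Nat.log2 n := by omega
      have h6 := Nat.mul_le_mul_left l h5
      rw [Nat.mul_add l f] at h6
      omega
    · rwa [Nat.sub_mul_mod h4]

theorem testBit_patternBit (p c q t : ℕ) (h : (c + 4 * p * q / 15) % (8 * p) = t) :
    (patternBit p c q).testBit t = true := by
  change (1 <<< ((c + 4 * p * q / 15) % (8 * p))).testBit t = true
  rw [h, Nat.testBit_shiftLeft]
  simp

theorem testBit_pattern (p c q t : ℕ) (hq : q < 30) (hq' : Nat.Coprime q 30)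
    (h : (c + 4 * p * q / 15) % (8 * p) = t) : (pattern p c).testBit t = true := by
  have h' := testBit_patternBit p c q t h
  have hmem : q = 1 ∨ q = 7 ∨ q = 11 ∨ q = 13 ∨ q = 17 ∨ q = 19 ∨ q = 23 ∨ q = 29 := by
    clear h h'
    decide +revert
  change Nat.testBit
    (((patternBit p c 1 ||| patternBit p c 7) ||| (patternBit p c 11 ||| patternBit p c 13)) |||
      ((patternBit p c 17 ||| patternBit p c 19) ||| (patternBit p c 23 ||| patternBit p c 29)))
    t = true
  simp only [Nat.testBit_or, Bool.or_eq_true]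
  rcases hmem with rfl | rfl | rfl | rfl | rfl | rfl | rfl | rfl <;> simp [h']

theorem testBit_mask (k₀ s p t : ℕ) (hp : 0 < p) (ht : t < 8 * s)
    (h : p ∣ 30 * k₀ + residue t) : (mask k₀ s p).testBit t = true := by
  change (extend (pattern p (8 * (p - k₀ % p))) (8 * p) (Nat.log2 (s / p)) (s / p)).testBit t = true
  obtain ⟨u, hu⟩ := h
  obtain ⟨h1, -, -, h2⟩ := residue_spec t
  have hcop : Nat.Coprime (u % 30) 30 := by
    have : Nat.Coprime (p * u) 30 := by
      rw [← hu, add_comm]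
      simpa [Nat.coprime_add_mul_left_left] using h2
    have := Nat.Coprime.coprime_mul_left this
    rw [Nat.Coprime, ← Nat.gcd_rec, Nat.gcd_comm]
    exact this
  refine testBit_extend _ _ _ _ ?_
    (testBit_pattern p _ (u % 30) _ (Nat.mod_lt _ (by norm_num)) hcop ?_)
  · have : s < p * (s / p + 1) := Nat.lt_mul_div_succ s hp
    rw [mul_assoc]
    omega
  · have hpos : 8 * k₀ + t = 8 * p * (u / 30) + 4 * p * (u % 30) / 15 := by
      have e1 : 8 * k₀ + t = 4 * (p * u) / 15 := by rw [← hu]; omega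
      have e2 : 4 * (p * u) = 15 * (8 * p * (u / 30)) + 4 * p * (u % 30) := by
        conv_lhs => rw [← Nat.div_add_mod u 30]
        ring
      rw [e1, e2, Nat.mul_add_div (by norm_num)]
    have hk : k₀ % p < p := Nat.mod_lt _ hp
    have hk' := Nat.div_add_mod k₀ p
    have e3 : 8 * (p - k₀ % p) + 4 * p * (u % 30) / 15 + 8 * p * (u / 30) =
        t + 8 * p * (k₀ / p + 1) := by
      have : 8 * p * (k₀ / p + 1) = 8 * (p * (k₀ / p)) + 8 * p := by ring
      rw [this]
      omega
    calc _ = (8 * (p - k₀ % p) + 4 * p * (u % 30) / 15 + 8 * p * (u / 30)) % (8 * p) := by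
          rw [Nat.add_mul_mod_self_left]
      _ = t % (8 * p) := by rw [e3, Nat.add_mul_mod_self_left]

theorem testBit_composites (k₀ s r t : ℕ) : ∀ acc : ℕ, (acc.testBit t = true ∨
    ∃ i < r, isSieving (2 * i + 3) = true ∧ (mask k₀ s (2 * i + 3)).testBit t = true) →
    (composites k₀ s r acc).testBit t = true := by
  induction r with
  | zero => rintro acc (h | ⟨i, hi, -⟩) <;> [exact h; omega]
  | succ r ih =>
    intro acc h
    have hstep : composites k₀ s (r + 1) acc = if isSieving (2 * r + 3) = true then
        composites k₀ s r (acc ||| mask k₀ s (2 * r + 3)) else composites k₀ s r acc := by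
      change (Bool.rec (composites k₀ s r acc)
        (composites k₀ s r (acc ||| mask k₀ s (2 * r + 3))) (isSieving (2 * r + 3)) : ℕ) = _
      cases isSieving (2 * r + 3) <;> rfl
    rw [hstep]
    rcases h with h | ⟨i, hi, hs, hm⟩
    · split_ifs
      · exact ih _ (Or.inl (by simp [h]))
      · exact ih _ (Or.inl h)
    · rcases Nat.lt_succ_iff_lt_or_eq.mp hi with h' | rfl
      · split_ifs <;> exact ih _ (Or.inr ⟨i, h', hs, hm⟩)
      · rw [if_pos hs]
        exact ih _ (Or.inl (by simp [hm]))

theorem primorial181_eq : primorial181 = primorial 181 := by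
  rw [primorial_eq_prod_primesLE]
  decide +kernel

theorem isSieving_of_prime {p : ℕ} (hp : p.Prime) (h7 : 7 ≤ p) : isSieving p = true := by
  change Nat.beq (Nat.gcd p (Bool.rec primorial181 30 (Nat.ble p 181))) 1 = true
  rw [Nat.beq_eq]
  rcases le_or_gt p 181 with h | h
  · have : Nat.ble p 181 = true := Nat.ble_eq.mpr h
    rw [this]
    change Nat.Coprime p 30
    rw [hp.coprime_iff_not_dvd]
    intro h30
    have : p ∣ 2 * 3 * 5 := h30
    simp only [hp.dvd_mul] at this
    rcases this with (h | h) | h <;> have := Nat.le_of_dvd (by norm_num) h <;> omega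
  · have : Nat.ble p 181 = false := by
      rw [Bool.eq_false_iff]; intro h'; exact absurd (Nat.ble_eq.mp h') (by omega)
    rw [this]
    change Nat.Coprime p primorial181
    rw [hp.coprime_iff_not_dvd, primorial181_eq, hp.dvd_primorial_iff]
    omega

/-- The integers which survive the sieve are primes. -/
theorem prime_of_testBit_composites {k₀ s r t : ℕ} (hk : 0 < k₀) (ht : t < 8 * s)
    (hr : 30 * (k₀ + s) ≤ (2 * r + 3) * (2 * r + 3))
    (h : (composites k₀ s r 0).testBit t = false) : (30 * k₀ + residue t).Prime := by
  obtain ⟨-, h1, -, h2⟩ := residue_spec t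
  by_contra hnp
  set N := 30 * k₀ + residue t with hN
  have hN2 : 2 ≤ N := by omega
  have hmp := Nat.minFac_prime (show N ≠ 1 by omega)
  have hsq : Nat.minFac N ^ 2 ≤ N := Nat.minFac_sq_le_self (by omega) hnp
  have hdvd := Nat.minFac_dvd N
  set p := Nat.minFac N
  have hcop : Nat.Coprime p 30 := by
    refine Nat.Coprime.coprime_dvd_left hdvd ?_
    rw [hN, add_comm]
    simpa [Nat.coprime_add_mul_left_left] using h2
  have hp2 : ¬ 2 ∣ p := fun hd => by
    have := Nat.dvd_gcd hd (show 2 ∣ 30 by norm_num)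
    rw [hcop] at this; omega
  have hp7 : 7 ≤ p := by
    by_contra hlt
    have hp2' := hmp.two_le
    interval_cases p <;> revert hcop <;> decide
  have hlt : p < 2 * r + 3 := by
    by_contra hge
    have : (2 * r + 3) * (2 * r + 3) ≤ p * p := Nat.mul_le_mul (by omega) (by omega)
    rw [sq] at hsq
    omega
  have hp3 : 2 * ((p - 3) / 2) + 3 = p := by omega
  rw [testBit_composites k₀ s r t 0 (Or.inr ⟨(p - 3) / 2, by omega, ?_, ?_⟩)] at h
  · exact absurd h (by simp)
  · rw [hp3]; exact isSieving_of_prime hmp hp7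
  · rw [hp3]; exact testBit_mask k₀ s p t hmp.pos ht hdvd

/-! ### Processing the sieved segment block by block -/

/-- Add up, in each field of `w` bits, the weights `1 + 2 * w * residue i` of the bits of `z`; the
ones of `m` are the lowest bits of the fields. -/
def blockSums (w m z i : ℕ) : ℕ → ℕ :=
  Nat.rec (fun acc => acc)
    (fun i ih acc => force (Nat.add acc (Nat.mul (Nat.add 1 (Nat.mul (Nat.mul 2 w) (residue i)))
      (Nat.land (Nat.shiftRight z i) m))) ih) i

/-- Pass from `a` to `a + h`, where `v` encodes the number `v % (2 * w)` of known primes in between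
and the sum `v / (2 * w)` of their distances to `a`. The numbers `L` and `D` are lower bounds,
scaled by `Q`, for `log a` and for the error term at `a`. -/
def blockStep (Q h w v a L D : ℕ) (k : ℕ → ℕ → ℕ → Bool) : Bool :=
  force (Nat.add a h) fun b =>
  force (Nat.add a b) fun s =>
  force (Nat.mod v (Nat.mul 2 w)) fun c =>
  force (Nat.div v (Nat.mul 2 w)) fun m =>
  force (Nat.add (Nat.div (Nat.mul (Nat.mul h s) Q)
    (Nat.mul 2 (Nat.mul a b))) 1) fun e =>
  Bool.rec (motive := fun _ => Bool) false
    (force (Nat.add (Nat.div (Nat.mul L (Nat.sub (Nat.mul c a) m)) (Nat.mul a a))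
      (Nat.div (Nat.mul m Q) (Nat.mul b b))) fun G =>
    force (Nat.add L (Nat.div (Nat.mul (Nat.mul 2 h) Q) s)) fun L' =>
    force (Nat.add (Nat.sub D e) (Nat.add G (Nat.div G b))) fun D' =>
    k b L' D')
    (Nat.ble (Nat.succ e) D)

/-- Run `blockStep` for the `2 ^ d` fields of `w` bits of `v`. -/
def walk (Q h w d : ℕ) : ℕ → ℕ → ℕ → ℕ → (ℕ → ℕ → ℕ → Bool) → Bool :=
  Nat.rec (fun v a L D k => blockStep Q h w v a L D k)
    (fun d ih v a L D k =>
      force (Nat.shiftRight v (Nat.mul w (Nat.pow 2 d))) fun hi =>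
      force (Nat.sub v (Nat.shiftLeft hi (Nat.mul w (Nat.pow 2 d)))) fun lo =>
      ih lo a L D fun a' L' D' => ih hi a' L' D' k) d

/-- Sieve `[30 * k₀, 30 * (k₀ + g * 2 ^ d))` by the odd numbers up to `2 * r + 1` and walk through
it in `2 ^ d` blocks, from the bounds `L`, `D` to the bounds `L'`, `D'`. -/
def segment (Q k₀ g d r L D L' D' : ℕ) : Bool :=
  force (Nat.mul 8 g) fun w =>
  force (Nat.mul g (Nat.pow 2 d)) fun s =>
  and (Nat.ble 1 g) <| and (Nat.ble g k₀) <|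
  and (Nat.ble (Nat.mul 30 (Nat.add k₀ s))
    (Nat.mul (Nat.add (Nat.mul 2 r) 3) (Nat.add (Nat.mul 2 r) 3))) <|
  and (Nat.ble (Nat.succ (Nat.mul w (Nat.add 1 (Nat.mul (Nat.mul 2 w) (Nat.mul 30 g)))))
    (Nat.pow 2 w)) <|
  force (Nat.xor (composites k₀ s r 0) (Nat.sub (Nat.pow 2 (Nat.mul 8 s)) 1)) fun z =>
  force (replicateBits d 1 w) fun m =>
  force (blockSums w m z w 0) fun v =>
  walk Q (Nat.mul 30 g) w d v (Nat.mul 30 k₀) L D fun _ L₁ D₁ =>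
    and (Nat.ble L' L₁) (Nat.ble D' D₁)

theorem land_sum_two_pow {w : ℕ} (hw : 0 < w) (n : ℕ) : ∀ x : ℕ,
    x &&& ∑ j ∈ Finset.range n, 2 ^ (w * j) =
      ∑ j ∈ Finset.range n, (x.testBit (w * j)).toNat * 2 ^ (w * j) := by
  induction n with
  | zero => simp
  | succ n ih =>
    intro x
    have hfac : ∀ f : ℕ → ℕ, ∑ j ∈ Finset.range (n + 1), f j * 2 ^ (w * j) =
        2 ^ w * ∑ j ∈ Finset.range n, f (j + 1) * 2 ^ (w * j) + f 0 := by
      intro f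
      rw [Finset.sum_range_succ', Finset.mul_sum]
      congr 1
      · refine Finset.sum_congr rfl fun j _ => ?_
        rw [mul_add, pow_add, mul_one]
        ring
      · simp
    have h1 := hfac fun _ => 1
    simp only [one_mul] at h1
    have h2 := ih (x >>> w)
    have h3 : ∀ j, (x >>> w).testBit (w * j) = x.testBit (w * (j + 1)) := by
      intro j
      rw [Nat.testBit_shiftRight]
      congr 1
      ring
    simp only [h3] at h2
    rw [h1, hfac fun j => (x.testBit (w * j)).toNat, ← h2]
    refine Nat.eq_of_testBit_eq fun i => ?_
    have hone : 1 < 2 ^ w := Nat.one_lt_two_pow hw.ne'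
    have hlt : (x.testBit (w * 0)).toNat < 2 ^ w := (Bool.toNat_le _).trans_lt hone
    rw [Nat.testBit_and, Nat.testBit_two_pow_mul_add _ hone, Nat.testBit_two_pow_mul_add _ hlt]
    split_ifs with hi
    · rw [mul_zero]
      rcases Nat.eq_zero_or_pos i with rfl | h0
      · cases x.testBit 0 <;> simp
      · have e1 : Nat.testBit 1 i = false := Nat.testBit_lt_two_pow (Nat.one_lt_two_pow h0.ne')
        have e2 : (x.testBit 0).toNat.testBit i = false :=
          Nat.testBit_lt_two_pow ((Bool.toNat_le _).trans_lt (Nat.one_lt_two_pow h0.ne'))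
        rw [e1, e2, Bool.and_false]
    · rw [Nat.testBit_and, Nat.testBit_shiftRight, Nat.add_sub_cancel' (not_lt.mp hi)]

theorem blockSums_eq (w m z n : ℕ) : ∀ acc, blockSums w m z n acc =
    acc + ∑ i ∈ Finset.range n, (1 + 2 * w * residue i) * ((z >>> i) &&& m) := by
  induction n with
  | zero => intro acc; rfl
  | succ n ih =>
    intro acc
    change blockSums w m z n (acc + (1 + 2 * w * residue n) * ((z >>> n) &&& m)) = _
    rw [ih, Finset.sum_range_succ]
    ring

/-- The field `j` of the number computed by `blockSums`. -/
def blockField (w z j : ℕ) : ℕ :=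
  ∑ i ∈ Finset.range w, (1 + 2 * w * residue i) * (z.testBit (w * j + i)).toNat

theorem blockSums_replicateBits {w : ℕ} (hw : 0 < w) (z d : ℕ) :
    blockSums w (replicateBits d 1 w) z w 0 =
      ∑ j ∈ Finset.range (2 ^ d), blockField w z j * 2 ^ (w * j) := by
  rw [blockSums_eq, replicateBits_eq _ _ _ (Nat.one_lt_two_pow hw.ne'), one_mul, zero_add]
  simp only [land_sum_two_pow hw, blockField, Finset.mul_sum, Finset.sum_mul]
  rw [Finset.sum_comm]
  refine Finset.sum_congr rfl fun j _ => Finset.sum_congr rfl fun i _ => ?_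
  rw [Nat.testBit_shiftRight, add_comm i]
  ring

/-- `v` encodes the number of elements and the sum of a set of `q < h` with `a + q` prime. -/
def BlockData (a h w v : ℕ) : Prop :=
  ∃ S : Finset ℕ, (∀ q ∈ S, q < h ∧ (a + q).Prime) ∧ S.card = v % (2 * w) ∧
    ∑ q ∈ S, q = v / (2 * w)

theorem blockField_lt {w g : ℕ} (hw : w = 8 * g)
    (h : w * (1 + 2 * w * (30 * g)) < 2 ^ w) (z j : ℕ) : blockField w z j < 2 ^ w := by
  refine lt_of_le_of_lt ?_ h
  have : ∀ i ∈ Finset.range w, (1 + 2 * w * residue i) * (z.testBit (w * j + i)).toNat ≤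
      1 + 2 * w * (30 * g) := by
    intro i hi
    have h1 := (residue_spec i).2.1
    have h2 : residue i ≤ 30 * g := by
      have := Finset.mem_range.mp hi
      omega
    calc _ ≤ (1 + 2 * w * residue i) * 1 := Nat.mul_le_mul_left _ (Bool.toNat_le _)
      _ ≤ _ := by rw [mul_one]; gcongr
  simpa [blockField] using Finset.sum_le_card_nsmul _ _ _ this

theorem blockData_blockField {w g k₀ z j : ℕ} (hg : 0 < g) (hw : w = 8 * g)
    (hz : ∀ i < w, z.testBit (w * j + i) = true → (30 * k₀ + residue (w * j + i)).Prime) :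
    BlockData (30 * k₀ + 30 * g * j) (30 * g) w (blockField w z j) := by
  set T := (Finset.range w).filter fun i => z.testBit (w * j + i) = true with hT
  have hval : blockField w z j = T.card + 2 * w * ∑ q ∈ T.image residue, q := by
    rw [Finset.sum_image residue_injective.injOn, Finset.card_eq_sum_ones, Finset.mul_sum,
      ← Finset.sum_add_distrib, hT, Finset.sum_filter, blockField]
    refine Finset.sum_congr rfl fun i _ => ?_
    cases z.testBit (w * j + i) <;> simp
  have hcard : T.card < 2 * w := by
    have : T.card ≤ (Finset.range w).card := Finset.card_filter_le _ _
    rw [Finset.card_range] at this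
    omega
  refine ⟨T.image residue, ?_, ?_, ?_⟩
  · simp only [Finset.mem_image, forall_exists_index, and_imp]
    rintro _ i hi rfl
    obtain ⟨hi, hb⟩ := Finset.mem_filter.mp hi
    have hi := Finset.mem_range.mp hi
    refine ⟨?_, ?_⟩
    · have := (residue_spec i).2.1
      omega
    · have := hz i hi hb
      rwa [hw, mul_assoc, residue_add, ← add_assoc, ← mul_assoc] at this
  · rw [Finset.card_image_of_injective _ residue_injective, hval, Nat.add_mul_mod_self_left,
      Nat.mod_eq_of_lt hcard]
  · rw [hval, Nat.add_mul_div_left _ _ (by omega), Nat.div_eq_of_lt hcard, zero_add]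

theorem sum_fields_lt {w n : ℕ} {f : ℕ → ℕ} (hf : ∀ j, f j < 2 ^ w) :
    ∑ j ∈ Finset.range n, f j * 2 ^ (w * j) < 2 ^ (w * n) := by
  induction n with
  | zero => simp
  | succ n ih =>
    rw [Finset.sum_range_succ, mul_add, pow_add, mul_one]
    have := Nat.mul_le_mul_right (2 ^ (w * n)) (Nat.succ_le_of_lt (hf n))
    rw [Nat.succ_mul] at this
    linarith

/-- Soundness of `walk` for an invariant `Inv` and an interval predicate `Good`. -/
theorem walk_sound {Inv : ℕ → ℕ → ℕ → Prop} {Good : ℕ → ℕ → Prop} {Q h w : ℕ}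
    (hgood : ∀ a b c, Good a b → Good b c → Good a c)
    (hstep : ∀ v a L D k, h ≤ a → BlockData a h w v → Inv a L D →
      blockStep Q h w v a L D k = true →
      Good a (a + h) ∧ ∃ L' D', Inv (a + h) L' D' ∧ k (a + h) L' D' = true) (d : ℕ) :
    ∀ (f : ℕ → ℕ) (a L D : ℕ) (k : ℕ → ℕ → ℕ → Bool), h ≤ a → (∀ j, f j < 2 ^ w) →
      (∀ j < 2 ^ d, BlockData (a + h * j) h w (f j)) → Inv a L D →
      walk Q h w d (∑ j ∈ Finset.range (2 ^ d), f j * 2 ^ (w * j)) a L D k = true →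
      Good a (a + h * 2 ^ d) ∧
        ∃ L' D', Inv (a + h * 2 ^ d) L' D' ∧ k (a + h * 2 ^ d) L' D' = true := by
  induction d with
  | zero =>
    intro f a L D k ha _ hdata hinv hwalk
    have h0 := hdata 0 (by simp)
    simp only [pow_zero, Finset.sum_range_one, mul_zero, mul_one, add_zero] at hwalk h0 ⊢
    exact hstep (f 0) a L D k ha h0 hinv hwalk
  | succ d ih =>
    intro f a L D k ha hf hdata hinv hwalk
    set lo := ∑ j ∈ Finset.range (2 ^ d), f j * 2 ^ (w * j) with hlo
    set hi := ∑ j ∈ Finset.range (2 ^ d), f (2 ^ d + j) * 2 ^ (w * j) with hhi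
    have hlt : lo < 2 ^ (w * 2 ^ d) := sum_fields_lt hf
    have hsum : ∑ j ∈ Finset.range (2 ^ (d + 1)), f j * 2 ^ (w * j) =
        lo + 2 ^ (w * 2 ^ d) * hi := by
      rw [pow_succ, mul_two, Finset.sum_range_add, Finset.mul_sum]
      congr 1
      refine Finset.sum_congr rfl fun j _ => ?_
      rw [mul_add, pow_add]
      ring
    have hshift : (lo + 2 ^ (w * 2 ^ d) * hi) >>> (w * 2 ^ d) = hi := by
      rw [Nat.shiftRight_eq_div_pow, Nat.add_mul_div_left _ _ (by positivity),
        Nat.div_eq_of_lt hlt, zero_add]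
    have hrest : lo + 2 ^ (w * 2 ^ d) * hi - hi <<< (w * 2 ^ d) = lo := by
      rw [Nat.shiftLeft_eq, mul_comm hi, Nat.add_sub_cancel]
    rw [hsum] at hwalk
    change walk Q h w d (lo + 2 ^ (w * 2 ^ d) * hi -
      ((lo + 2 ^ (w * 2 ^ d) * hi) >>> (w * 2 ^ d)) <<< (w * 2 ^ d)) a L D (fun a' L' D' =>
        walk Q h w d ((lo + 2 ^ (w * 2 ^ d) * hi) >>> (w * 2 ^ d)) a' L' D' k) = true at hwalk
    rw [hshift, hrest] at hwalk
    obtain ⟨g₁, L₁, D₁, i₁, w₁⟩ := ih f a L D _ ha hf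
      (fun j hj => hdata j (by rw [pow_succ]; omega)) hinv hwalk
    obtain ⟨g₂, i₂⟩ := ih (fun j => f (2 ^ d + j)) _ L₁ D₁ k (by omega) (fun j => hf _)
      (fun j hj => by
        have := hdata (2 ^ d + j) (by rw [pow_succ]; omega)
        rwa [mul_add, ← add_assoc] at this) i₁ w₁
    have e : a + h * 2 ^ d + h * 2 ^ d = a + h * 2 ^ (d + 1) := by rw [pow_succ]; ring
    rw [e] at g₂ i₂
    exact ⟨hgood _ _ _ g₁ g₂, i₂⟩

theorem segment_sound {Inv : ℕ → ℕ → ℕ → Prop} {Good : ℕ → ℕ → Prop} {Q : ℕ}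
    (hgood : ∀ a b c, Good a b → Good b c → Good a c)
    (hmono : ∀ a L D L' D', L' ≤ L → D' ≤ D → Inv a L D → Inv a L' D')
    (hstep : ∀ h w v a L D k, 0 < h → h ≤ a → BlockData a h w v → Inv a L D →
      blockStep Q h w v a L D k = true →
      Good a (a + h) ∧ ∃ L' D', Inv (a + h) L' D' ∧ k (a + h) L' D' = true)
    {k₀ g d r L D L' D' : ℕ} (hinv : Inv (30 * k₀) L D)
    (hseg : segment Q k₀ g d r L D L' D' = true) :
    Good (30 * k₀) (30 * (k₀ + g * 2 ^ d)) ∧ Inv (30 * (k₀ + g * 2 ^ d)) L' D' := by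
  set z := composites k₀ (g * 2 ^ d) r 0 ^^^ (2 ^ (8 * (g * 2 ^ d)) - 1) with hz
  have hseg' : (Nat.ble 1 g && (Nat.ble g k₀ &&
    (Nat.ble (30 * (k₀ + g * 2 ^ d)) ((2 * r + 3) * (2 * r + 3)) &&
    (Nat.ble (Nat.succ (8 * g * (1 + 2 * (8 * g) * (30 * g)))) (2 ^ (8 * g)) &&
    walk Q (30 * g) (8 * g) d (blockSums (8 * g) (replicateBits d 1 (8 * g)) z (8 * g) 0) (30 * k₀)
      L D fun _ L₁ D₁ => Nat.ble L' L₁ && Nat.ble D' D₁)))) = true := hseg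
  simp only [Bool.and_eq_true, Nat.ble_eq] at hseg'
  obtain ⟨hg, hgk, hr, hfit, hwalk⟩ := hseg'
  rw [blockSums_replicateBits (by omega)] at hwalk
  have hprime : ∀ t < 8 * (g * 2 ^ d), z.testBit t = true → (30 * k₀ + residue t).Prime := by
    intro t ht hb
    refine prime_of_testBit_composites (by omega) ht hr ?_
    rw [hz, Nat.testBit_xor, Nat.testBit_two_pow_sub_one] at hb
    simpa [ht] using hb
  obtain ⟨h1, L₁, D₁, h2, h3⟩ := walk_sound hgood (fun v a L D k => hstep (30 * g) (8 * g) v a L D k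
    (by omega)) d _ (30 * k₀) L D _ (by omega) (blockField_lt rfl hfit z)
    (fun j hj => blockData_blockField hg rfl fun i hi hb => hprime _ (by
      have : 8 * g * (j + 1) ≤ 8 * g * 2 ^ d := Nat.mul_le_mul_left _ hj
      rw [mul_add] at this
      rw [← mul_assoc]
      omega) hb) hinv hwalk
  rw [Bool.and_eq_true, Nat.ble_eq, Nat.ble_eq] at h3
  have e : 30 * k₀ + 30 * g * 2 ^ d = 30 * (k₀ + g * 2 ^ d) := by ring
  rw [e] at h1 h2
  exact ⟨h1, hmono _ _ _ _ _ h3.1 h3.2 h2⟩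

/-! ### Real estimates -/

/-- The sum of `f` over the primes below `a`. -/
noncomputable def primeSum (f : ℕ → ℝ) (a : ℕ) : ℝ :=
  ∑ p ∈ (Finset.range a).filter Nat.Prime, f p

theorem primeSum_succ (f : ℕ → ℝ) (a : ℕ) :
    primeSum f (a + 1) = primeSum f a + if a.Prime then f a else 0 := by
  rw [primeSum, primeSum, Finset.sum_filter, Finset.sum_filter, Finset.sum_range_succ]

theorem primeSum_add_le {f : ℕ → ℝ} {a h : ℕ} {S : Finset ℕ} (hf : ∀ p, p.Prime → 0 ≤ f p)
    (hS : ∀ q ∈ S, q < h ∧ (a + q).Prime) :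
    primeSum f a + ∑ q ∈ S, f (a + q) ≤ primeSum f (a + h) := by
  have hinj : Function.Injective fun q : ℕ => a + q := fun x y hxy => by simpa using hxy
  rw [primeSum, primeSum, ← Finset.sum_image (f := f) (g := fun q => a + q) hinj.injOn,
    ← Finset.sum_union]
  · refine Finset.sum_le_sum_of_subset_of_nonneg ?_ fun p hp _ => hf p (Finset.mem_filter.mp hp).2
    intro p hp
    rcases Finset.mem_union.mp hp with hp | hp
    · obtain ⟨h1, h2⟩ := Finset.mem_filter.mp hp
      have := Finset.mem_range.mp h1
      exact Finset.mem_filter.mpr ⟨Finset.mem_range.mpr (by omega), h2⟩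
    · obtain ⟨q, hq, rfl⟩ := Finset.mem_image.mp hp
      obtain ⟨h1, h2⟩ := hS q hq
      exact Finset.mem_filter.mpr ⟨Finset.mem_range.mpr (by omega), h2⟩
  · rw [Finset.disjoint_left]
    intro p hp hp'
    obtain ⟨q, hq, rfl⟩ := Finset.mem_image.mp hp'
    have := Finset.mem_range.mp (Finset.mem_filter.mp hp).1
    omega

theorem primeSum_mono {f : ℕ → ℝ} (hf : ∀ p, p.Prime → 0 ≤ f p) {a b : ℕ} (h : a ≤ b) :
    primeSum f a ≤ primeSum f b := by
  obtain ⟨n, rfl⟩ := Nat.exists_eq_add_of_le h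
  simpa using primeSum_add_le (S := ∅) (a := a) (h := n) hf (by simp)

theorem log_div_self_nonneg (p : ℕ) : 0 ≤ Real.log p / p :=
  div_nonneg (Real.log_natCast_nonneg p) (Nat.cast_nonneg p)

theorem log_div_mul_nonneg (p : ℕ) (hp : p.Prime) :
    0 ≤ Real.log p / ((p : ℝ) * ((p : ℝ) - 1)) := by
  have : (1 : ℝ) ≤ p := by exact_mod_cast hp.one_le
  exact div_nonneg (Real.log_natCast_nonneg p) (mul_nonneg (by linarith) (by linarith))

/-- Positivity of the error term, with `c` in place of `-E`, follows on `[a, b)` from a lower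
bound at `a`. -/
theorem pos_of_log_div_lt {a b : ℕ} {c δ x : ℝ} (ha : 0 < a)
    (hδ : δ ≤ primeSum (fun p => Real.log p / p) a + c - Real.log a)
    (hb : Real.log (b / a) < δ) (hax : a ≤ x) (hxb : x < b) :
    0 < primeSum (fun p => Real.log p / p) (⌊x⌋₊ + 1) + c - Real.log x := by
  have ha' : (0 : ℝ) < a := by exact_mod_cast ha
  have h1 : primeSum (fun p => Real.log p / p) a ≤
      primeSum (fun p => Real.log p / p) (⌊x⌋₊ + 1) :=
    primeSum_mono (fun p _ => log_div_self_nonneg p) ((Nat.le_floor hax).trans (Nat.le_succ _))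
  have h2 : Real.log x ≤ Real.log b := Real.log_le_log (by linarith) hxb.le
  rw [Real.log_div (by linarith) ha'.ne'] at hb
  linarith

theorem summable_primes_log_div_mul :
    Summable fun p : Nat.Primes => Real.log (p : ℕ) / (((p : ℕ) : ℝ) * (((p : ℕ) : ℝ) - 1)) := by
  have h1 : Summable fun n : ℕ => 4 * (1 / (n : ℝ) ^ (3 / 2 : ℝ)) :=
    (Real.summable_one_div_nat_rpow.mpr (by norm_num)).mul_left 4
  have h2 := h1.comp_injective (i := fun p : Nat.Primes => (p : ℕ)) Subtype.val_injective
  refine Summable.of_nonneg_of_le (fun p => log_div_mul_nonneg p p.2) (fun p => ?_) h2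
  have hp : (2 : ℝ) ≤ (p : ℕ) := by exact_mod_cast p.2.two_le
  change Real.log (p : ℕ) / (((p : ℕ) : ℝ) * (((p : ℕ) : ℝ) - 1)) ≤
    4 * (1 / ((p : ℕ) : ℝ) ^ (3 / 2 : ℝ))
  generalize ((p : ℕ) : ℝ) = y at hp ⊢
  have hlog : Real.log y ≤ y ^ (1 / 2 : ℝ) / (1 / 2) :=
    Real.log_le_rpow_div (by linarith) (by norm_num)
  have hy : y ^ (1 / 2 : ℝ) * y ^ (3 / 2 : ℝ) = y * y := by
    rw [← Real.rpow_add (by linarith)]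
    norm_num
    ring
  have hpos : 0 < y ^ (3 / 2 : ℝ) := Real.rpow_pos_of_pos (by linarith) _
  rw [mul_one_div, div_le_div_iff₀ (by nlinarith) hpos]
  calc Real.log y * y ^ (3 / 2 : ℝ) ≤ y ^ (1 / 2 : ℝ) / (1 / 2) * y ^ (3 / 2 : ℝ) := by gcongr
    _ = 2 * (y * y) := by rw [← hy]; ring
    _ ≤ 4 * (y * (y - 1)) := by nlinarith

theorem primeSum_le_tsum (a : ℕ) :
    primeSum (fun p => Real.log p / ((p : ℝ) * ((p : ℝ) - 1))) a ≤
      ∑' p : Nat.Primes, Real.log (p : ℕ) / (((p : ℕ) : ℝ) * (((p : ℕ) : ℝ) - 1)) := by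
  refine le_of_eq_of_le ?_
    (Summable.sum_le_tsum (L := SummationFilter.unconditional Nat.Primes)
      ((Finset.range a).subtype Nat.Prime) (fun p _ => log_div_mul_nonneg p p.2)
      summable_primes_log_div_mul)
  exact (Finset.sum_subtype_eq_sum_filter
    (fun p : ℕ => Real.log p / ((p : ℝ) * ((p : ℝ) - 1)))).symm

theorem mertensDelta_eq (x : ℝ) :
    mertensDelta x = primeSum (fun p => Real.log p / p) (⌊x⌋₊ + 1) +
      (Real.eulerMascheroniConstant +
        ∑' p : Nat.Primes, Real.log (p : ℕ) / (((p : ℕ) : ℝ) * (((p : ℕ) : ℝ) - 1))) -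
      Real.log x := by
  rw [mertensDelta, mertensE, primeSum]
  ring

theorem le_log_div {a b : ℝ} (ha : 0 < a) (hab : a ≤ b) :
    2 * (b - a) / (a + b) ≤ Real.log (b / a) := by
  have h := Real.le_log_one_add_of_nonneg (x := (b - a) / a) (div_nonneg (by linarith) ha.le)
  have e1 : 1 + (b - a) / a = b / a := by field_simp; ring
  have e2 : 2 * ((b - a) / a) / ((b - a) / a + 2) = 2 * (b - a) / (a + b) := by
    have : b - a + 2 * a ≠ 0 := by linarith
    have : a + b ≠ 0 := by linarith
    field_simp
    ring
  rwa [e1, e2] at h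

theorem log_div_le {a b : ℝ} (ha : 0 < a) (hab : a ≤ b) :
    Real.log (b / a) ≤ (b - a) * (a + b) / (2 * (a * b)) := by
  have hb : 0 < b := by linarith
  have h := Real.self_le_sinh_iff.mpr (Real.log_nonneg ((one_le_div ha).mpr hab))
  rw [Real.sinh_eq, Real.exp_neg, Real.exp_log (by positivity)] at h
  refine h.trans_eq ?_
  field_simp
  ring

/-- The trapezoidal approximations `H n - log n - 1 / (2 n)` of `γ` increase. -/
theorem harmonic_sub_le_eulerMascheroniConstant {n : ℕ} (hn : 0 < n) :
    (harmonic n : ℝ) - Real.log n - 1 / (2 * n) ≤ Real.eulerMascheroniConstant := by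
  have hmono : Monotone fun m : ℕ =>
      (harmonic (m + n) : ℝ) - Real.log ((m + n : ℕ) : ℝ) - 1 / (2 * ((m + n : ℕ) : ℝ)) := by
    refine monotone_nat_of_le_succ fun m => ?_
    have hpos : (0 : ℝ) < ((m + n : ℕ) : ℝ) := by exact_mod_cast (by omega : 0 < m + n)
    have h := log_div_le hpos (show ((m + n : ℕ) : ℝ) ≤ ((m + n : ℕ) : ℝ) + 1 by linarith)
    rw [Real.log_div (by linarith) hpos.ne'] at h
    rw [show m + 1 + n = m + n + 1 by ring, harmonic_succ]
    push_cast at h hpos ⊢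
    generalize (m : ℝ) + n = y at *
    have : (y + 1 - y) * (y + (y + 1)) / (2 * (y * (y + 1))) =
        (y + 1)⁻¹ + 1 / (2 * y) - 1 / (2 * (y + 1)) := by
      field_simp
      ring
    linarith
  have hlim : Filter.Tendsto (fun m : ℕ =>
      (harmonic (m + n) : ℝ) - Real.log ((m + n : ℕ) : ℝ) - 1 / (2 * ((m + n : ℕ) : ℝ)))
      Filter.atTop (nhds (Real.eulerMascheroniConstant - 0)) := by
    refine ((Filter.tendsto_add_atTop_iff_nat n).mpr Real.tendsto_harmonic_sub_log).sub ?_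
    have := (Filter.tendsto_add_atTop_iff_nat n).mpr (tendsto_one_div_atTop_nhds_zero_nat (𝕜 := ℝ))
    have := this.const_mul (1 / 2)
    rw [mul_zero] at this
    refine this.congr fun m => ?_
    rw [one_div_mul_one_div]
  have := hmono.ge_of_tendsto hlim 0
  simpa using this

theorem eulerMascheroniConstant_gt : 5772155 / 10 ^ 7 < Real.eulerMascheroniConstant := by
  refine lt_of_lt_of_le ?_ (harmonic_sub_le_eulerMascheroniConstant (n := 1024) (by norm_num))
  have hlog : Real.log (1024 : ℕ) = 10 * Real.log 2 := by
    rw [show ((1024 : ℕ) : ℝ) = 2 ^ 10 by norm_num, Real.log_pow]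
    norm_num
  have hsum : (750917567 / 10 ^ 8 : ℚ) < harmonic 1024 := by
    decide +kernel
  have hsum' : ((750917567 / 10 ^ 8 : ℚ) : ℝ) < harmonic 1024 := by exact_mod_cast hsum
  have := Real.log_two_lt_d9
  rw [hlog]
  generalize (harmonic 1024 : ℝ) = H at hsum' ⊢
  norm_num at hsum' ⊢
  linarith

theorem div_lt_natCast_div_add_one (m : ℕ) {n : ℕ} (hn : 0 < n) :
    (m : ℝ) / n < (m / n : ℕ) + 1 := by
  rw [div_lt_iff₀ (by exact_mod_cast hn), mul_comm]
  exact_mod_cast Nat.lt_mul_div_succ m hn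

/-! ### Soundness of the walk through the blocks -/

/-- `L` and `D` are lower bounds, scaled by `Q`, for `log a` and for the error term at `a`
without the tail of the sum in `E`. -/
def BlockInv (Q a L D : ℕ) : Prop :=
  (L : ℝ) / Q ≤ Real.log a ∧
    (D : ℝ) / Q ≤ primeSum (fun p => Real.log p / ((p : ℝ) - 1)) a +
      Real.eulerMascheroniConstant - Real.log a

/-- The error term is positive on `[a, b)`. -/
def DeltaPos (a b : ℕ) : Prop := ∀ x : ℝ, a ≤ x → x < b → 0 < mertensDelta x

theorem DeltaPos.trans {a b c : ℕ} (h : DeltaPos a b) (h' : DeltaPos b c) : DeltaPos a c :=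
  fun x h1 h2 => (lt_or_ge x b).elim (h x h1) fun h3 => h' x h3 h2

theorem BlockInv.mono {Q a L D L' D' : ℕ} (hL : L' ≤ L) (hD : D' ≤ D) (h : BlockInv Q a L D) :
    BlockInv Q a L' D' :=
  ⟨le_trans (by gcongr) h.1, le_trans (by gcongr) h.2⟩

theorem primeSum_log_div_sub_one (a : ℕ) :
    primeSum (fun p => Real.log p / ((p : ℝ) - 1)) a = primeSum (fun p => Real.log p / p) a +
      primeSum (fun p => Real.log p / ((p : ℝ) * ((p : ℝ) - 1))) a := by
  rw [primeSum, primeSum, primeSum, ← Finset.sum_add_distrib]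
  refine Finset.sum_congr rfl fun p hp => ?_
  have h2 : (2 : ℝ) ≤ p := by exact_mod_cast (Finset.mem_filter.mp hp).2.two_le
  have : (p : ℝ) - 1 ≠ 0 := by linarith
  field_simp
  ring

theorem le_log_div_of_lt {a q h l : ℝ} (ha : 0 < a) (hq : 0 ≤ q) (hqh : q ≤ h)
    (hl : 0 ≤ l) (hla : l ≤ Real.log a) :
    l * (a - q) / (a * a) + q / ((a + h) * (a + h)) ≤ Real.log (a + q) / (a + q) := by
  have h1 : q / (a + q) ≤ Real.log ((a + q) / a) := by
    have := Real.one_sub_inv_le_log_of_pos (x := (a + q) / a) (by positivity)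
    refine le_of_eq_of_le ?_ this
    field_simp
    ring
  rw [Real.log_div (by positivity) ha.ne'] at h1
  have h2 : l * (a - q) / (a * a) ≤ l / (a + q) := by
    rw [div_le_div_iff₀ (by positivity) (by positivity)]
    nlinarith [mul_nonneg hl (mul_nonneg hq hq)]
  have h3 : q / ((a + h) * (a + h)) ≤ q / (a + q) / (a + q) := by
    rw [div_div]
    have : 0 ≤ a + h := by linarith
    gcongr
  have h4 : (l + q / (a + q)) / (a + q) ≤ Real.log (a + q) / (a + q) := by
    gcongr
    linarith
  rw [add_div] at h4
  linarith

theorem blockStep_eq (Q h w v a L D : ℕ) (k : ℕ → ℕ → ℕ → Bool) :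
    blockStep Q h w v a L D k =
      (decide (h * (a + (a + h)) * Q / (2 * (a * (a + h))) + 1 < D) &&
        k (a + h) (L + 2 * h * Q / (a + (a + h)))
          (D - (h * (a + (a + h)) * Q / (2 * (a * (a + h))) + 1) +
            (L * (v % (2 * w) * a - v / (2 * w)) / (a * a) +
              v / (2 * w) * Q / ((a + h) * (a + h)) +
              (L * (v % (2 * w) * a - v / (2 * w)) / (a * a) +
                v / (2 * w) * Q / ((a + h) * (a + h))) / (a + h)))) := by
  have hrec : ∀ (c : Prop) [Decidable c] (b x : Bool), (b = true ↔ c) →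
      (Bool.rec false x b : Bool) = (decide c && x) := by
    intro c _ b x hb
    cases b <;> simp [← hb]
  have hdiv : ∀ m n : ℕ, Nat.div m n = m / n := fun _ _ => rfl
  have hmod : ∀ m n : ℕ, Nat.mod m n = m % n := fun _ _ => rfl
  simp only [blockStep, force_eq, Nat.add_eq, Nat.mul_eq, Nat.sub_eq, hdiv, hmod]
  refine hrec _ _ _ ?_
  rw [Nat.ble_eq, Nat.succ_le_iff]

theorem blockStep_sound {Q h w v a L D : ℕ} {k : ℕ → ℕ → ℕ → Bool} (hQ : 0 < Q) (hh : 0 < h)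
    (hha : h ≤ a) (hdata : BlockData a h w v) (hinv : BlockInv Q a L D)
    (hstep : blockStep Q h w v a L D k = true) :
    DeltaPos a (a + h) ∧ ∃ L' D', BlockInv Q (a + h) L' D' ∧ k (a + h) L' D' = true := by
  obtain ⟨S, hS, hcard, hsum⟩ := hdata
  obtain ⟨hL, hD⟩ := hinv
  set e := h * (a + (a + h)) * Q / (2 * (a * (a + h))) + 1 with he
  set G := L * (v % (2 * w) * a - v / (2 * w)) / (a * a) +
    v / (2 * w) * Q / ((a + h) * (a + h)) with hG
  rw [blockStep_eq, ← he, ← hG, Bool.and_eq_true, decide_eq_true_iff] at hstep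
  obtain ⟨heD, hstep⟩ := hstep
  have hQ' : (0 : ℝ) < Q := by exact_mod_cast hQ
  have ha : 0 < a := by omega
  have ha' : (0 : ℝ) < a := by exact_mod_cast ha
  have hh' : (0 : ℝ) < h := by exact_mod_cast hh
  have hup := log_div_le ha' (show (a : ℝ) ≤ (a + h : ℕ) by push_cast; linarith)
  have hlow := le_log_div ha' (show (a : ℝ) ≤ (a + h : ℕ) by push_cast; linarith)
  have he' : Real.log ((a + h : ℕ) / a) < (e : ℝ) / Q := by
    refine hup.trans_lt ?_
    have := div_lt_natCast_div_add_one (h * (a + (a + h)) * Q)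
      (show 0 < 2 * (a * (a + h)) by positivity)
    rw [he, lt_div_iff₀ (by positivity), Nat.cast_add_one]
    refine lt_of_eq_of_lt ?_ this
    push_cast
    ring
  have heD' : (e : ℝ) / Q < (D : ℝ) / Q := by gcongr
  refine ⟨fun x hax hxb => ?_, _, _, ⟨?_, ?_⟩, hstep⟩
  · rw [mertensDelta_eq]
    refine pos_of_log_div_lt ha ?_ (he'.trans heD') hax hxb
    rw [primeSum_log_div_sub_one] at hD
    have := primeSum_le_tsum a
    linarith
  · have h1 : ((2 * h * Q / (a + (a + h)) : ℕ) : ℝ) ≤ _ := Nat.cast_div_le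
    rw [Real.log_div (by positivity) ha'.ne'] at hlow
    have h2 : ((2 * h * Q : ℕ) : ℝ) / (a + (a + h) : ℕ) / Q =
        2 * (((a + h : ℕ) : ℝ) - a) / (a + (a + h : ℕ)) := by
      push_cast
      field_simp
      ring
    have h3 : ((2 * h * Q / (a + (a + h)) : ℕ) : ℝ) / Q ≤
      ((2 * h * Q : ℕ) : ℝ) / (a + (a + h) : ℕ) / Q := by gcongr
    rw [Nat.cast_add, add_div]
    linarith
  · have hm : v / (2 * w) ≤ v % (2 * w) * a := by
      rw [← hsum, ← hcard]
      simpa using Finset.sum_le_card_nsmul S (fun q => q) a fun q hq =>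
        ((hS q hq).1.trans_le hha).le
    have hl : (0 : ℝ) ≤ (L : ℝ) / Q := by positivity
    have hGle : (G : ℝ) / Q ≤ ∑ q ∈ S, Real.log ((a + q : ℕ) : ℝ) / (a + q : ℕ) := by
      have h1 : ((L * (v % (2 * w) * a - v / (2 * w)) / (a * a) : ℕ) : ℝ) ≤ _ := Nat.cast_div_le
      have h2 : ((v / (2 * w) * Q / ((a + h) * (a + h)) : ℕ) : ℝ) ≤ _ :=
        Nat.cast_div_le
      rw [← hsum, ← hcard] at hm h1
      rw [← hsum] at h2
      rw [hG, ← hsum, ← hcard]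
      push_cast [Nat.cast_sub hm] at h1 h2 ⊢
      have h3 : ∑ q ∈ S, ((L : ℝ) / Q * (a - q) / (a * a) + q / ((a + h) * (a + h))) ≤
          ∑ q ∈ S, Real.log ((a : ℝ) + q) / (a + q) :=
        Finset.sum_le_sum fun q hq => le_log_div_of_lt ha' (Nat.cast_nonneg q)
          (by exact_mod_cast (hS q hq).1.le) hl hL
      refine le_trans ?_ h3
      rw [Finset.sum_add_distrib, ← Finset.sum_div, ← Finset.sum_div, ← Finset.mul_sum,
        Finset.sum_sub_distrib, Finset.sum_const, nsmul_eq_mul]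
      calc _ ≤ ((L : ℝ) * (S.card * a - ∑ q ∈ S, (q : ℝ)) / (a * a) +
            (∑ q ∈ S, (q : ℝ)) * Q / ((a + h) * (a + h))) / Q := by
            gcongr
        _ = _ := by field_simp
    have hterm : ∀ q ∈ S, Real.log ((a + q : ℕ) : ℝ) / (a + q : ℕ) * (1 + 1 / (a + h : ℕ)) ≤
        Real.log ((a + q : ℕ) : ℝ) / (((a + q : ℕ) : ℝ) - 1) := by
      intro q hq
      obtain ⟨h1, h2⟩ := hS q hq
      have h3 : (2 : ℝ) ≤ (a + q : ℕ) := by exact_mod_cast h2.two_le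
      have h4 : ((a + q : ℕ) : ℝ) ≤ (a + h : ℕ) := by exact_mod_cast (by omega : a + q ≤ a + h)
      have h5 : 0 ≤ Real.log ((a + q : ℕ) : ℝ) := Real.log_natCast_nonneg _
      rw [div_mul_eq_mul_div, mul_div_assoc, div_eq_mul_one_div (Real.log _) (_ - 1)]
      refine mul_le_mul_of_nonneg_left ?_ h5
      generalize ((a + q : ℕ) : ℝ) = p at *
      generalize ((a + h : ℕ) : ℝ) = b at *
      have hb : 0 < b := by linarith
      rw [div_le_div_iff₀ (by linarith) (by linarith)]
      have : 1 / b * (p - 1) ≤ 1 := by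
        rw [div_mul_eq_mul_div, div_le_one hb]
        linarith
      nlinarith
    have hprimes := primeSum_add_le (f := fun p => Real.log p / ((p : ℝ) - 1)) (a := a) (h := h)
      (fun p hp => div_nonneg (Real.log_natCast_nonneg p)
        (sub_nonneg.mpr (by exact_mod_cast hp.one_le))) hS
    have hgain : ((G + G / (a + h) : ℕ) : ℝ) / Q ≤
        ∑ q ∈ S, Real.log ((a + q : ℕ) : ℝ) / (((a + q : ℕ) : ℝ) - 1) := by
      refine le_trans ?_ (Finset.sum_le_sum hterm)
      rw [← Finset.sum_mul]
      have h1 : ((G / (a + h) : ℕ) : ℝ) ≤ (G : ℝ) / (a + h : ℕ) := Nat.cast_div_le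
      calc _ ≤ ((G : ℝ) + (G : ℝ) / (a + h : ℕ)) / Q := by
            rw [Nat.cast_add]
            gcongr
        _ = (G : ℝ) / Q * (1 + 1 / (a + h : ℕ)) := by ring
        _ ≤ _ := by gcongr
    rw [Real.log_div (by positivity) ha'.ne'] at he'
    rw [Nat.cast_add, Nat.cast_sub heD.le, add_div, sub_div]
    linarith

theorem deltaPos_of_segment {Q k₀ g d r L D L' D' : ℕ} (hQ : 0 < Q)
    (hinv : BlockInv Q (30 * k₀) L D) (hseg : segment Q k₀ g d r L D L' D' = true) :
    DeltaPos (30 * k₀) (30 * (k₀ + g * 2 ^ d)) ∧ BlockInv Q (30 * (k₀ + g * 2 ^ d)) L' D' :=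
  segment_sound (Inv := BlockInv Q) (Good := DeltaPos) (fun _ _ _ => DeltaPos.trans)
    (fun _ _ _ _ _ => BlockInv.mono) (fun _ _ _ _ _ _ _ => blockStep_sound hQ) hinv hseg

/-! ### Small arguments -/

/-- A primality test for integers below `182 ^ 2`. -/
def isSmallPrime (n : ℕ) : Bool :=
  Bool.rec (Nat.beq (Nat.gcd n primorial181) 1)
    (Nat.beq (Nat.land (Nat.shiftRight 0x28208820a00a08800228a20208828828208a20a08a28ac n) 1) 1)
    (Nat.ble n 181)

/-- A lower bound, scaled by `Q`, for the partial sum of order `n` of the series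
`2 * artanh (1 / y)`. -/
def artanhSum (Q y n : ℕ) : ℕ :=
  Nat.rec 0 (fun i ih => Nat.add ih (Nat.div (Nat.mul 2 Q)
    (Nat.mul (Nat.add (Nat.mul 2 i) 1) (Nat.pow y (Nat.add (Nat.mul 2 i) 1))))) n

/-- Pass from `a` to `a + 1`. The numbers `L`, `D` and `T` are lower bounds, scaled by `Q`, for
`log a`, for the error term at `a` and for the partial sum at `a` of the series in `E`. -/
def unitStep (Q n a L D T : ℕ) (k : ℕ → ℕ → ℕ → ℕ → Bool) : Bool :=
  force (Nat.add (Nat.mul 2 a) 1) fun y =>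
  force (artanhSum Q y (Nat.add n 1)) fun l =>
  force (Nat.add l (Nat.add (Nat.add n 2) (Nat.div (Nat.mul 2 Q)
    (Nat.mul (Nat.pow y (Nat.add (Nat.mul 2 n) 1)) (Nat.sub (Nat.mul y y) 1))))) fun e =>
  force (Nat.add a 1) fun b =>
  force (Nat.add L l) fun L' =>
  force (Nat.sub D e) fun D' =>
  and (Nat.ble (Nat.succ e) D) <|
  Bool.rec (motive := fun _ => Bool) (k b L' D' T)
    (force (Nat.add D' (Nat.div L a)) fun D'' =>
     force (Nat.add T (Nat.div L (Nat.mul a (Nat.sub a 1)))) fun T' =>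
     k b L' D'' T')
    (isSmallPrime a)

/-- Iterate `unitStep`. -/
def unitSteps (Q n : ℕ) (k : ℕ → ℕ → ℕ → ℕ → Bool) (f : ℕ) : ℕ → ℕ → ℕ → ℕ → Bool :=
  Nat.rec k (fun _ ih a L D T => unitStep Q n a L D T ih) f

theorem prime_of_isSmallPrime {n : ℕ} (hn : n < 182 * 182) (h1 : 1 < n)
    (h : isSmallPrime n = true) : n.Prime := by
  rcases le_or_gt n 181 with h181 | h181
  · have key : ∀ m < 182, isSmallPrime m = true → m.Prime := by decide +kernel
    exact key n (by omega) h
  · have hble : Nat.ble n 181 = false := by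
      rw [Bool.eq_false_iff, Ne, Nat.ble_eq]
      omega
    rw [isSmallPrime, hble] at h
    have hcop : Nat.Coprime n primorial181 := Nat.eq_of_beq_eq_true h
    by_contra hnp
    have hmp := Nat.minFac_prime h1.ne'
    have hsq : Nat.minFac n ^ 2 ≤ n := Nat.minFac_sq_le_self (by omega) hnp
    have hle : Nat.minFac n ≤ 181 := by
      by_contra hgt
      have : 182 * 182 ≤ n.minFac * n.minFac := Nat.mul_le_mul (by omega) (by omega)
      rw [sq] at hsq
      omega
    rw [primorial181_eq] at hcop
    exact hmp.one_lt.ne' (Nat.eq_one_of_dvd_coprimes hcop (Nat.minFac_dvd n)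
      (hmp.dvd_primorial_iff.mpr hle))

theorem artanhSum_bounds {Q y : ℕ} (hQ : 0 < Q) (hy : 0 < y) (n : ℕ) :
    (artanhSum Q y n : ℝ) / Q ≤
      2 * ∑ i ∈ Finset.range n, (1 / (y : ℝ)) ^ (2 * i + 1) / (2 * i + 1) ∧
    2 * ∑ i ∈ Finset.range n, (1 / (y : ℝ)) ^ (2 * i + 1) / (2 * i + 1) ≤
      ((artanhSum Q y n : ℝ) + n) / Q := by
  have hQ' : (0 : ℝ) < Q := by exact_mod_cast hQ
  have hy' : (0 : ℝ) < y := by exact_mod_cast hy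
  induction n with
  | zero => simp [artanhSum]
  | succ n ih =>
    have hrec : artanhSum Q y (n + 1) =
        artanhSum Q y n + 2 * Q / ((2 * n + 1) * y ^ (2 * n + 1)) := rfl
    have h1 : ((2 * Q / ((2 * n + 1) * y ^ (2 * n + 1)) : ℕ) : ℝ) ≤ _ := Nat.cast_div_le
    have h2 := div_lt_natCast_div_add_one (2 * Q)
      (show 0 < (2 * n + 1) * y ^ (2 * n + 1) by positivity)
    have h3 : ((2 * Q : ℕ) : ℝ) / ((2 * n + 1) * y ^ (2 * n + 1) : ℕ) =
        2 * ((1 / (y : ℝ)) ^ (2 * n + 1) / (2 * n + 1)) * Q := by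
      push_cast
      rw [one_div_pow]
      field_simp
    rw [h3] at h1 h2
    rw [div_le_iff₀ hQ', le_div_iff₀ hQ'] at ih ⊢
    obtain ⟨ih1, ih2⟩ := ih
    rw [hrec, Finset.sum_range_succ, mul_add (2 : ℝ), add_mul _ _ (Q : ℝ), Nat.cast_add,
      Nat.cast_add_one]
    constructor <;> linarith

theorem log_succ_div_bounds {a : ℕ} (ha : 0 < a) (n : ℕ) :
    2 * ∑ i ∈ Finset.range n, (1 / ((2 * a + 1 : ℕ) : ℝ)) ^ (2 * i + 1) / (2 * i + 1) ≤
      Real.log ((a + 1 : ℕ) / a) ∧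
    Real.log ((a + 1 : ℕ) / a) ≤
      2 * ∑ i ∈ Finset.range n, (1 / ((2 * a + 1 : ℕ) : ℝ)) ^ (2 * i + 1) / (2 * i + 1) +
        2 * ((1 / ((2 * a + 1 : ℕ) : ℝ)) ^ (2 * n + 1) /
          (1 - (1 / ((2 * a + 1 : ℕ) : ℝ)) ^ 2)) := by
  have ha' : (0 : ℝ) < a := by exact_mod_cast ha
  have hx0 : 0 ≤ 1 / ((2 * a + 1 : ℕ) : ℝ) := by positivity
  have hx1 : 1 / ((2 * a + 1 : ℕ) : ℝ) < 1 := by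
    rw [div_lt_one (by positivity)]
    push_cast
    linarith
  have h1 := Real.sum_range_le_log_div hx0 hx1 n
  have h2 := Real.log_div_le_sum_range_add hx0 hx1 n
  have e : (1 + 1 / ((2 * a + 1 : ℕ) : ℝ)) / (1 - 1 / ((2 * a + 1 : ℕ) : ℝ)) =
      (a + 1 : ℕ) / a := by
    push_cast
    have : (2 * (a : ℝ) + 1) - 1 ≠ 0 := by simpa using ha.ne'
    field_simp
    ring
  rw [e] at h1 h2
  constructor <;> linarith

/-- The invariant of `unitStep`: `L`, `D` and `T` are lower bounds, scaled by `Q`, for `log a`, for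
the error term at `a` with `τ` in place of the series in `E`, and for the partial sum at `a` of
this series. -/
def UnitInv (Q : ℕ) (τ : ℝ) (a L D T : ℕ) : Prop :=
  (L : ℝ) / Q ≤ Real.log a ∧
  (D : ℝ) / Q ≤ primeSum (fun p => Real.log p / p) a + (Real.eulerMascheroniConstant + τ) -
    Real.log a ∧
  (T : ℝ) / Q ≤ primeSum (fun p => Real.log p / ((p : ℝ) * ((p : ℝ) - 1))) a

/-- The error term with `τ` in place of the series in `E` is positive on `[a, b)`. -/
def UnitPos (τ : ℝ) (a b : ℕ) : Prop := ∀ x : ℝ, a ≤ x → x < b →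
  0 < primeSum (fun p => Real.log p / p) (⌊x⌋₊ + 1) + (Real.eulerMascheroniConstant + τ) -
    Real.log x

theorem unitStep_sound {Q n a L D T : ℕ} {τ : ℝ} {k : ℕ → ℕ → ℕ → ℕ → Bool} (hQ : 0 < Q)
    (ha : 2 ≤ a) (ha' : a < 182 * 182) (hinv : UnitInv Q τ a L D T)
    (hstep : unitStep Q n a L D T k = true) :
    UnitPos τ a (a + 1) ∧
      ∃ L' D' T', UnitInv Q τ (a + 1) L' D' T' ∧ k (a + 1) L' D' T' = true := by
  obtain ⟨hL, hD, hT⟩ := hinv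
  have hQ' : (0 : ℝ) < Q := by exact_mod_cast hQ
  have ha2 : (2 : ℝ) ≤ a := by exact_mod_cast ha
  set y := 2 * a + 1 with hy
  set l := artanhSum Q y (n + 1) with hl
  set R := 2 * Q / (y ^ (2 * n + 1) * (y * y - 1)) with hR
  set e := l + (n + 2 + R) with he
  have hstep' : (Nat.ble (Nat.succ e) D && (Bool.rec (k (a + 1) (L + l) (D - e) T)
      (k (a + 1) (L + l) (D - e + L / a) (T + L / (a * (a - 1)))) (isSmallPrime a) : Bool)) =
      true := hstep
  rw [Bool.and_eq_true, Nat.ble_eq, Nat.succ_le_iff] at hstep'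
  obtain ⟨heD, hk⟩ := hstep'
  obtain ⟨hl1, hl2⟩ := artanhSum_bounds hQ (show 0 < y by omega) (n + 1)
  obtain ⟨hlog1, hlog2⟩ := log_succ_div_bounds (show 0 < a by omega) (n + 1)
  rw [← hy] at hlog1 hlog2
  have hRe : 2 * ((1 / (y : ℝ)) ^ (2 * (n + 1) + 1) / (1 - (1 / (y : ℝ)) ^ 2)) <
      ((R : ℝ) + 1) / Q := by
    have hyy : 1 < y * y := by nlinarith
    have h1 := div_lt_natCast_div_add_one (2 * Q)
      (show 0 < y ^ (2 * n + 1) * (y * y - 1) from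
        Nat.mul_pos (Nat.pow_pos (by omega)) (by omega))
    rw [lt_div_iff₀ hQ']
    refine lt_of_eq_of_lt ?_ h1
    have hy0 : (y : ℝ) ≠ 0 := by rw [hy]; positivity
    have hyy' : (y : ℝ) * y - 1 ≠ 0 := by
      have : (1 : ℝ) < y * y := by exact_mod_cast hyy
      linarith
    have hyy2 : (y : ℝ) ^ 2 - 1 ≠ 0 := by rwa [sq]
    push_cast [Nat.cast_sub hyy.le]
    rw [show 2 * (n + 1) + 1 = 2 * n + 1 + 2 by ring, pow_add, one_div_pow, one_div_pow]
    field_simp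
  have hup : Real.log ((a + 1 : ℕ) / a) < (e : ℝ) / Q := by
    rw [he]
    push_cast at hl2 ⊢
    have : ((l : ℝ) + (n + 2 + R)) / Q = (l + (n + 1)) / Q + (R + 1) / Q := by ring
    push_cast at hlog2
    linarith
  have heD' : (e : ℝ) / Q < (D : ℝ) / Q := by gcongr
  refine ⟨fun x hax hxb => pos_of_log_div_lt (by omega) hD (hup.trans heD') hax hxb, ?_⟩
  rw [Real.log_div (by positivity) (by positivity)] at hup hlog1
  have hL' : ((L + l : ℕ) : ℝ) / Q ≤ Real.log (a + 1 : ℕ) := by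
    rw [Nat.cast_add, add_div]
    linarith
  have hD' : ((D - e : ℕ) : ℝ) / Q = (D : ℝ) / Q - (e : ℝ) / Q := by
    rw [Nat.cast_sub heD.le, sub_div]
  cases hp : isSmallPrime a with
  | false =>
    rw [hp] at hk
    refine ⟨_, _, _, ⟨hL', ?_, ?_⟩, hk⟩
    · have := primeSum_mono (fun p _ => log_div_self_nonneg p) a.le_succ
      rw [hD']
      linarith
    · exact hT.trans (primeSum_mono log_div_mul_nonneg a.le_succ)
  | true =>
    rw [hp] at hk
    have hprime := prime_of_isSmallPrime ha' (by omega) hp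
    refine ⟨_, _, _, ⟨hL', ?_, ?_⟩, hk⟩
    · have h1 : ((L / a : ℕ) : ℝ) ≤ (L : ℝ) / a := Nat.cast_div_le
      have h2 : ((L / a : ℕ) : ℝ) / Q ≤ Real.log a / a := by
        calc ((L / a : ℕ) : ℝ) / Q ≤ (L : ℝ) / a / Q := by gcongr
          _ = (L : ℝ) / Q / a := by ring
          _ ≤ _ := by gcongr
      rw [primeSum_succ, if_pos hprime, Nat.cast_add, add_div, hD']
      linarith
    · have h1 : ((L / (a * (a - 1)) : ℕ) : ℝ) ≤ (L : ℝ) / (a * (a - 1) : ℕ) := Nat.cast_div_le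
      rw [Nat.cast_mul, Nat.cast_sub (by omega), Nat.cast_one] at h1
      have hpos : 0 < (a : ℝ) * (a - 1) := by nlinarith
      have h2 : ((L / (a * (a - 1)) : ℕ) : ℝ) / Q ≤ Real.log a / ((a : ℝ) * (a - 1)) := by
        calc ((L / (a * (a - 1)) : ℕ) : ℝ) / Q ≤ (L : ℝ) / (a * (a - 1)) / Q := by gcongr
          _ = (L : ℝ) / Q / (a * (a - 1)) := by ring
          _ ≤ _ := by gcongr
      rw [primeSum_succ, if_pos hprime, Nat.cast_add, add_div]
      linarith

theorem unitSteps_sound {Q n : ℕ} {τ : ℝ} {k : ℕ → ℕ → ℕ → ℕ → Bool} (hQ : 0 < Q) (f : ℕ) :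
    ∀ a L D T : ℕ, 2 ≤ a → a + f ≤ 182 * 182 → UnitInv Q τ a L D T →
      unitSteps Q n k f a L D T = true →
      UnitPos τ a (a + f) ∧
        ∃ L' D' T', UnitInv Q τ (a + f) L' D' T' ∧ k (a + f) L' D' T' = true := by
  induction f with
  | zero =>
    intro a L D T _ _ hinv h
    exact ⟨fun x h1 h2 => absurd h1 (not_le.mpr h2), L, D, T, hinv, h⟩
  | succ f ih =>
    intro a L D T ha haf hinv h
    obtain ⟨h1, L₁, D₁, T₁, h2, h3⟩ := unitStep_sound hQ ha (by omega) hinv h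
    obtain ⟨h4, h5⟩ := ih (a + 1) L₁ D₁ T₁ (by omega) (by omega) h2 h3
    rw [show a + 1 + f = a + (f + 1) by ring] at h4 h5
    exact ⟨fun x hax hxb => (lt_or_ge x (a + 1 : ℕ)).elim (h1 x hax) fun h => h4 x h hxb, h5⟩

/-! ### The computation up to `10 ^ 8` -/

/-- The error term is positive on `[2, 30 * k)`, and the walk through the blocks can go on at
`30 * k` with the bounds `L` and `D`. -/
def Reached (k L D : ℕ) : Prop :=
  DeltaPos 2 (30 * k) ∧ BlockInv 18446744073709551616 (30 * k) L D

theorem Reached.step {k₀ k₁ L D : ℕ} (h : Reached k₀ L D) (g d r L' D' : ℕ)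
    (hk : k₀ + g * 2 ^ d = k₁)
    (hseg : segment 18446744073709551616 k₀ g d r L D L' D' = true) : Reached k₁ L' D' := by
  subst hk
  obtain ⟨h1, h2⟩ := deltaPos_of_segment (by norm_num) h.2 hseg
  exact ⟨h.1.trans h1, h2⟩

theorem unitInv_two : UnitInv 18446744073709551616 (13933491966141558208 / 18446744073709551616) 2
    12786308640407511063 11794929920388970797 0 := by
  have hsum : ∀ f, primeSum f 2 = 0 := by
    intro f
    rw [primeSum, Finset.sum_filter, Finset.sum_range_succ, Finset.sum_range_one]
    simp [Nat.not_prime_zero, Nat.not_prime_one]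
  have h1 := Real.log_two_gt_d9
  have h2 := Real.log_two_lt_d9
  have h3 := eulerMascheroniConstant_gt
  refine ⟨?_, ?_, ?_⟩
  · norm_num at h1 ⊢
    linarith
  · rw [hsum]
    norm_num at h2 h3 ⊢
    linarith
  · rw [hsum]
    norm_num

set_option maxRecDepth 100000 in
theorem unitSteps_two : unitSteps 18446744073709551616 4
    (unitSteps 18446744073709551616 0 (fun _ L D T => Nat.ble 191790124718534889860 L &&
      (Nat.ble 93101840557224296 D && Nat.ble 13933491966141558208 T)) 31736)
    1022 2 12786308640407511063 11794929920388970797 0 = true := by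
  decide +kernel

/-- The error term is positive on `[2, 32760)`; the partial sum at `32760` of the series in `E`
is large enough. -/
theorem reached_of_unitSteps : Reached 1092 191790124718534889860 93101840557224296 ∧
    (13933491966141558208 / 18446744073709551616 : ℝ) ≤
      ∑' p : Nat.Primes, Real.log (p : ℕ) / (((p : ℕ) : ℝ) * (((p : ℕ) : ℝ) - 1)) := by
  obtain ⟨h1, L₁, D₁, T₁, h2, h3⟩ := unitSteps_sound (by norm_num) 1022 2 _ _ _ le_rfl
    (by norm_num) unitInv_two unitSteps_two
  obtain ⟨h4, L₂, D₂, T₂, ⟨hL, hD, hT⟩, h5⟩ := unitSteps_sound (by norm_num) 31736 (2 + 1022) _ _ _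
    (by norm_num) (by norm_num) h2 h3
  rw [show 2 + 1022 + 31736 = 30 * 1092 by norm_num] at h4 hL hD hT
  rw [Bool.and_eq_true, Bool.and_eq_true, Nat.ble_eq, Nat.ble_eq, Nat.ble_eq] at h5
  obtain ⟨hL', hD', hT'⟩ := h5
  have hτ : (13933491966141558208 / 18446744073709551616 : ℝ) ≤
      primeSum (fun p => Real.log p / ((p : ℝ) * ((p : ℝ) - 1))) (30 * 1092) := by
    refine le_trans ?_ hT
    rw [Nat.cast_ofNat]
    gcongr
    exact_mod_cast hT'
  have htsum := hτ.trans (primeSum_le_tsum (30 * 1092))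
  have hdelta : ∀ a b, UnitPos (13933491966141558208 / 18446744073709551616) a b →
      DeltaPos a b := by
    intro a b h x hax hxb
    have := h x hax hxb
    rw [mertensDelta_eq]
    linarith
  refine ⟨⟨(hdelta _ _ h1).trans (hdelta _ _ h4), BlockInv.mono hL' hD' ⟨hL, ?_⟩⟩, htsum⟩
  rw [primeSum_log_div_sub_one]
  linarith

set_option maxRecDepth 100000 in
theorem reached_last : ∃ L D, Reached 3425348 L D := by
  have h := reached_of_unitSteps.1
  replace h := h.step (k₁ := 17476) 2 13 361 242939579401278324736 33286189817528320 rfl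
    (by decide +kernel)
  replace h := h.step (k₁ := 148548) 8 14 1055 282417080419848552448 8752520578990080 rfl
    (by decide +kernel)
  replace h := h.step (k₁ := 279620) 8 14 1447 294085077700475617280 6068428011995136 rfl
    (by decide +kernel)
  replace h := h.step (k₁ := 410692) 32 12 1754 301176227534062223360 6962313785507840 rfl
    (by decide +kernel)
  replace h := h.step (k₁ := 541764) 32 12 2015 306285734733503528960 3830466582937600 rfl
    (by decide +kernel)
  replace h := h.step (k₁ := 672836) 32 12 2245 310282611662570651648 5383604066582528 rfl
    (by decide +kernel)
  replace h := h.step (k₁ := 803908) 32 12 2454 313565822566442991616 3372979551469568 rfl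
    (by decide +kernel)
  replace h := h.step (k₁ := 934980) 32 12 2647 316352024394602643456 4111310199455744 rfl
    (by decide +kernel)
  replace h := h.step (k₁ := 1066052) 32 12 2827 318772094167882399744 3883831551590400 rfl
    (by decide +kernel)
  replace h := h.step (k₁ := 1197124) 32 12 2995 320911176919980965888 1734020031315968 rfl
    (by decide +kernel)
  replace h := h.step (k₁ := 1328196) 32 12 3155 322827786563784540160 4080090082181120 rfl
    (by decide +kernel)
  replace h := h.step (k₁ := 1459268) 32 12 3307 324563870696253423616 2237768155529216 rfl
    (by decide +kernel)
  replace h := h.step (k₁ := 1590340) 32 12 3453 326150528458318413824 2922811144273920 rfl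
    (by decide +kernel)
  replace h := h.step (k₁ := 1721412) 32 12 3592 327611456249703432192 2956376313692160 rfl
    (by decide +kernel)
  replace h := h.step (k₁ := 1852484) 32 12 3726 328965125492092960768 1675861879160832 rfl
    (by decide +kernel)
  replace h := h.step (k₁ := 1983556) 32 12 3856 330226214133141864448 2050855473774592 rfl
    (by decide +kernel)
  replace h := h.step (k₁ := 2114628) 32 12 3981 331406579168805126144 1850435119874048 rfl
    (by decide +kernel)
  replace h := h.step (k₁ := 2245700) 32 12 4103 332515936214538256384 2452967491895296 rfl
    (by decide +kernel)
  replace h := h.step (k₁ := 2376772) 32 12 4221 333562345996242911232 2344571107278848 rfl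
    (by decide +kernel)
  replace h := h.step (k₁ := 2507844) 32 12 4336 334552570080933183488 2512972479987712 rfl
    (by decide +kernel)
  replace h := h.step (k₁ := 2638916) 32 12 4448 335492335893397635072 1914103715069952 rfl
    (by decide +kernel)
  replace h := h.step (k₁ := 2769988) 32 12 4557 336386537407136137216 2464821601632256 rfl
    (by decide +kernel)
  replace h := h.step (k₁ := 2901060) 32 12 4664 337239389402405273600 1933907809271808 rfl
    (by decide +kernel)
  replace h := h.step (k₁ := 3032132) 32 12 4768 338054547609338511360 1782819449733120 rfl
    (by decide +kernel)
  replace h := h.step (k₁ := 3163204) 32 12 4870 338835203403385143296 1666219677581312 rfl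
    (by decide +kernel)
  replace h := h.step (k₁ := 3294276) 32 12 4970 339584159267885678592 1701468474179584 rfl
    (by decide +kernel)
  replace h := h.step (k₁ := 3425348) 32 12 5068 340303889524909408256 2013983179538432 rfl
    (by decide +kernel)
  exact ⟨_, _, h⟩

end Mertens

/-- For all `0 < x ≤ 10⁸` the error term in Mertens's first theorem is positive
(Rosser–Schoenfeld computations). -/
theorem mertensDelta_pos_up_to_1e8 :
    ∀ x : ℝ, 0 < x → x ≤ 10 ^ 8 → 0 < mertensDelta x := by
  intro x hx hx'
  rcases lt_or_ge x 2 with h | h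
  · have h1 := Mertens.reached_of_unitSteps.2
    have h2 := Mertens.eulerMascheroniConstant_gt
    have h3 := Real.log_two_lt_d9
    have h4 : Real.log x ≤ Real.log 2 := Real.log_le_log hx h.le
    have h5 : 0 ≤ Mertens.primeSum (fun p => Real.log p / p) (⌊x⌋₊ + 1) :=
      Finset.sum_nonneg fun p _ => Mertens.log_div_self_nonneg p
    rw [Mertens.mertensDelta_eq]
    norm_num at h1 h2 h3
    linarith
  · obtain ⟨L, D, hpos, -⟩ := Mertens.reached_last
    refine hpos x (by exact_mod_cast h) (hx'.trans_lt ?_)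
    norm_num
end

section
/- Let γ₁ denote the infimum of the ordinates of the Riemann zeta function (the positive imaginary parts of its nontrivial zeros). For every ε > 0 there exists T₀ such that for every T ≥ T₀ there exist real numbers 2 ≤ x₁ < x₂ < ⋯ < x_N ≤ T with N ≥ (γ₁/π − ε) · log T such that (ψ(x_i) − x_i) and (ψ(x_{i+1}) − x_{i+1}) have strictly opposite signs for each 1 ≤ i < N; that is, the number of sign changes W^ψ(T) of ψ(x) − x on [2, T] satisfies liminf_{T→∞} W^ψ(T)/log T ≥ γ₁/π. -/
/-- The Chebyshev function `ψ(x) = Σ_{n ≤ x} Λ(n)`. -/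
noncomputable def chebyshevPsi (x : ℝ) : ℝ :=
  ∑ n ∈ Finset.Icc 1 ⌊x⌋₊, ArithmeticFunction.vonMangoldt n

/-- The set of ordinates of the Riemann zeta function: positive imaginary parts of
nontrivial zeros. -/
def zetaOrdinates : Set ℝ :=
  {t : ℝ | 0 < t ∧ ∃ ρ : ℂ, riemannZeta ρ = 0 ∧ 0 < ρ.re ∧ ρ.re < 1 ∧ ρ.im = t}

/-- `f` takes values of alternating strict sign along some `n` increasing points of `s`. -/
def HasAlternatingChain {α : Type*} [Preorder α] (f : α → ℝ) (s : Set α) (n : ℕ) : Prop :=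
  ∃ x : ℕ → α, (∀ i < n, x i ∈ s) ∧ (∀ i j, i < j → j < n → x i < x j) ∧
    ∀ i, i + 1 < n → f (x i) * f (x (i + 1)) < 0

/-- If no alternating chain of `n + 1` points of `S` ends at a point where `c * f` is negative,
then multiplying `c * f` by at most `n` factors `x - b` makes it nonnegative on `S`. -/
theorem exists_list_prod_sub_mul_nonneg (f : ℝ → ℝ) (a : ℝ) (n : ℕ) :
    ∀ (c : ℝ) (S : Set ℝ) (B : ℝ), S ⊆ Set.Ioc a B →
      (¬ ∃ x : ℕ → ℝ, (∀ i ≤ n, x i ∈ S) ∧ (∀ i j, i < j → j ≤ n → x i < x j) ∧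
        (∀ i < n, f (x i) * f (x (i + 1)) < 0) ∧ c * f (x n) < 0) →
      ∃ l : List ℝ, l.length ≤ n ∧ (∀ b ∈ l, a < b ∧ b ≤ B) ∧
        ∀ x ∈ S, 0 ≤ c * f x * (l.map (x - ·)).prod := by
  induction n with
  | zero =>
    intro c S B _ h
    refine ⟨[], le_rfl, by simp, fun x hx => ?_⟩
    by_contra hneg
    exact h ⟨fun _ => x, fun _ _ => hx, fun i j hij hj => by omega, fun i hi => by omega,
      by simpa using hneg⟩
  | succ n ih =>
    intro c S B hS h
    rcases Set.eq_empty_or_nonempty {x ∈ S | c * f x < 0} with hE | hE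
    · refine ⟨[], by simp, by simp, fun x hx => ?_⟩
      by_contra hneg
      have : x ∈ {x ∈ S | c * f x < 0} := ⟨hx, by simpa using hneg⟩
      simp [hE] at this
    have hbdd : BddAbove {x ∈ S | c * f x < 0} := ⟨B, fun x hx => (hS hx.1).2⟩
    set b := sSup {x ∈ S | c * f x < 0} with hb
    have hbB : b ≤ B := csSup_le hE fun x hx => (hS hx.1).2
    have hab : a < b := by
      obtain ⟨x, hx⟩ := hE
      exact (hS hx.1).1.trans_le (le_csSup hbdd hx)
    obtain ⟨l, hl, hlb, hpos⟩ := ih (-c) (S ∩ Set.Iio b) b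
      (fun x hx => ⟨(hS hx.1).1, (Set.mem_Iio.mp hx.2).le⟩) (by
        rintro ⟨x, hxS, hmono, halt, hlast⟩
        obtain ⟨y, hy, hxy⟩ := exists_lt_of_lt_csSup hE (hxS n le_rfl).2
        refine h ⟨fun i => if i ≤ n then x i else y, fun i hi => ?_, fun i j hij hj => ?_,
          fun i hi => ?_, by simpa using hy.2⟩
        · by_cases hin : i ≤ n
          · simpa [hin] using (hxS i hin).1
          · simpa [hin] using hy.1
        · have hin : i ≤ n := by omega
          by_cases hjn : j ≤ n
          · simpa [hin, hjn] using hmono i j hij hjn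
          · simp only [hin, hjn, if_true, if_false]
            rcases hin.lt_or_eq with h' | h'
            · exact (hmono i n h' le_rfl).trans hxy
            · exact h' ▸ hxy
        · have hin : i ≤ n := by omega
          rcases hin.lt_or_eq with h' | h'
          · simpa [hin, Nat.succ_le_of_lt h'] using halt i h'
          · subst h'
            simp only [le_refl, if_true, Nat.not_succ_le_self, if_false]
            have h1 := hy.2
            have h2 : 0 < c * f (x i) := by linarith
            have hc : c ≠ 0 := by rintro rfl; simp at h1
            have h3 : c ^ 2 * (f (x i) * f y) < 0 := by nlinarith
            have h4 : 0 < c ^ 2 := by positivity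
            by_contra hge
            nlinarith)
    refine ⟨b :: l, by simpa using hl, ?_, fun x hx => ?_⟩
    · intro b' hb'
      rcases List.mem_cons.mp hb' with rfl | hb'
      · exact ⟨hab, hbB⟩
      · exact ⟨(hlb b' hb').1, (hlb b' hb').2.trans hbB⟩
    · rw [List.map_cons, List.prod_cons]
      rcases lt_trichotomy x b with hxb | hxb | hxb
      · have := hpos x ⟨hx, hxb⟩
        have := mul_nonneg this (sub_nonneg.mpr hxb.le)
        linarith
      · simp [hxb]
      · have h1 : 0 ≤ c * f x := by
          by_contra hneg
          exact absurd (le_csSup hbdd ⟨hx, not_le.mp hneg⟩) (not_le.mpr hxb)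
        refine mul_nonneg h1 (mul_nonneg (sub_nonneg.mpr hxb.le) (List.prod_nonneg ?_))
        intro z hz
        obtain ⟨b', hb', rfl⟩ := List.mem_map.mp hz
        linarith [(hlb b' hb').2]

/-- A discrete Rolle theorem for the operator `e ↦ e (k + 1) - b * e k`. -/
theorem HasAlternatingChain.succ_sub_mul {e : ℕ → ℝ} {b : ℝ} (hb : 0 < b) {n : ℕ}
    (h : HasAlternatingChain e Set.univ (n + 1)) :
    HasAlternatingChain (fun k => e (k + 1) - b * e k) Set.univ n := by
  obtain ⟨x, -, hmono, halt⟩ := h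
  have key : ∀ i, ∃ k, i < n →
      x i ≤ k ∧ k < x (i + 1) ∧ 0 < (e (k + 1) - b * e k) * e (x (i + 1)) := by
    intro i
    by_cases hi : i < n
    swap
    · exact ⟨0, fun h => absurd h hi⟩
    by_contra! hcon
    have hlt := hmono i (i + 1) (Nat.lt_succ_self i) (by omega)
    have hprod := halt i (by omega)
    have hstep : ∀ k, x i ≤ k → k ≤ x (i + 1) →
        e k / b ^ k * e (x (i + 1)) ≤ e (x i) / b ^ (x i) * e (x (i + 1)) := by
      intro k hk
      induction k, hk using Nat.le_induction with
      | base => exact fun _ => le_rfl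
      | succ k hk ih =>
        intro hk'
        refine le_trans ?_ (ih (by omega))
        have := (hcon k).2 hk (by omega)
        have hpos : 0 < b ^ (k + 1) := by positivity
        have : (e (k + 1) / b ^ (k + 1) - e k / b ^ k) * e (x (i + 1)) =
            ((e (k + 1) - b * e k) * e (x (i + 1))) / b ^ (k + 1) := by
          field_simp
          ring
        have h0 : ((e (k + 1) - b * e k) * e (x (i + 1))) / b ^ (k + 1) ≤ 0 :=
          div_nonpos_of_nonpos_of_nonneg (by assumption) hpos.le
        linarith
    have h1 := hstep _ hlt.le le_rfl
    have hne : e (x (i + 1)) ≠ 0 := by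
      intro h0; simp [h0] at hprod
    have h2 : 0 < e (x (i + 1)) / b ^ (x (i + 1)) * e (x (i + 1)) := by
      have : 0 < e (x (i + 1)) ^ 2 / b ^ (x (i + 1)) := by positivity
      rw [div_mul_eq_mul_div, ← sq]; exact this
    have h3 : e (x i) / b ^ (x i) * e (x (i + 1)) < 0 := by
      rw [div_mul_eq_mul_div]
      exact div_neg_of_neg_of_pos hprod (by positivity)
    linarith
  choose y hy using key
  have hstep : ∀ i, i + 1 < n → y i < y (i + 1) := fun i hi =>
    (hy i (by omega)).2.1.trans_le (hy (i + 1) hi).1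
  refine ⟨y, fun _ _ => trivial, fun i j hij hj => ?_, fun i hi => ?_⟩
  · induction j, Nat.succ_le_of_lt hij using Nat.le_induction with
    | base => exact hstep i hj
    | succ j hij' ih => exact (ih (by omega) (by omega)).trans (hstep j hj)
  · have h1 := (hy i (by omega)).2.2
    have h2 := (hy (i + 1) hi).2.2
    have h3 := halt (i + 1) (by omega)
    have h4 := mul_pos h1 h2
    simp only
    by_contra hge
    push Not at hge
    nlinarith

open MeasureTheory in
/-- Variation diminishing property of the moments `∫ h * L ^ k`. -/
theorem not_hasAlternatingChain_moments {X : Type*} [MeasurableSpace X] {μ : Measure X}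
    {L : X → ℝ} (hL : ∀ᵐ x ∂μ, 0 ≤ L x) (l : List ℝ) (hl : ∀ b ∈ l, 0 < b) :
    ∀ h : X → ℝ, (∀ k : ℕ, Integrable (fun x => h x * L x ^ k) μ) →
      (∀ᵐ x ∂μ, 0 ≤ h x * (l.map (L x - ·)).prod) →
      ¬ HasAlternatingChain (fun k : ℕ => ∫ x, h x * L x ^ k ∂μ) Set.univ (l.length + 2) := by
  induction l with
  | nil =>
    intro h _ hpos hchain
    have hnn : ∀ k : ℕ, 0 ≤ ∫ x, h x * L x ^ k ∂μ := fun k => by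
      refine integral_nonneg_of_ae ?_
      filter_upwards [hpos, hL] with x hx hLx
      exact mul_nonneg (by simpa using hx) (pow_nonneg hLx k)
    obtain ⟨x, -, -, halt⟩ := hchain
    exact absurd (halt 0 (by simp)) (not_lt.mpr (mul_nonneg (hnn _) (hnn _)))
  | cons b l ih =>
    intro h hint hpos hchain
    refine ih (fun b' hb' => hl b' (List.mem_cons_of_mem _ hb')) (fun x => h x * (L x - b))
      (fun k => ?_) ?_ ?_
    · refine ((hint (k + 1)).sub ((hint k).const_mul b)).congr (ae_of_all _ fun x => ?_)
      simp only [Pi.sub_apply]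
      ring
    · filter_upwards [hpos] with x hx
      simpa [mul_assoc] using hx
    · have hchain' : HasAlternatingChain (fun k : ℕ => ∫ x, h x * L x ^ k ∂μ) Set.univ
          (l.length + 2 + 1) := hchain
      convert hchain'.succ_sub_mul (hl b List.mem_cons_self) using 2 with k
      rw [← integral_const_mul, ← integral_sub (hint (k + 1)) ((hint k).const_mul b)]
      congr 1 with x
      ring

/-- A real sequence close to `M * r ^ k * cos (k * θ + φ)` on `[m, K]` alternates in sign about
`(K - m) * θ / π` times. -/
theorem hasAlternatingChain_of_near_cos {d : ℕ → ℝ} {M r θ φ : ℝ} (hM : 0 < M) (hr : 0 < r)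
    (hθ : 0 < θ) (hθ' : θ ≤ Real.pi / 2) {m n : ℕ} {K : ℝ}
    (hK : n * (Real.pi / θ) + m + 2 ≤ K)
    (hd : ∀ k : ℕ, m ≤ k → (k : ℝ) ≤ K →
      |d k - M * r ^ k * Real.cos (k * θ + φ)| ≤ M * r ^ k / 2) :
    HasAlternatingChain d Set.univ n := by
  have hpi := Real.pi_pos
  set j₀ : ℤ := ⌈((m + 1) * θ + φ) / Real.pi⌉ with hj₀
  have hj1 : (m + 1) * θ + φ ≤ j₀ * Real.pi := by
    have := Int.le_ceil (((m + 1) * θ + φ) / Real.pi)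
    rwa [div_le_iff₀ hpi] at this
  have hj2 : j₀ * Real.pi < (m + 1) * θ + φ + Real.pi := by
    have := Int.ceil_lt_add_one (((m + 1) * θ + φ) / Real.pi)
    rw [← hj₀, ← sub_lt_iff_lt_add, lt_div_iff₀ hpi] at this
    linarith
  set t : ℕ → ℝ := fun i => ((j₀ + i) * Real.pi - φ) / θ with ht
  have htθ : ∀ i, t i * θ = (j₀ + i) * Real.pi - φ := fun i => by
    simp only [ht]; field_simp
  have htm : ∀ i, (m : ℝ) + 1 ≤ t i := fun i => by
    rw [ht, le_div_iff₀ hθ]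
    have : (0 : ℝ) ≤ i * Real.pi := by positivity
    linarith
  set k : ℕ → ℕ := fun i => ⌊t i + 1 / 2⌋₊ with hk
  have hk1 : ∀ i, (k i : ℝ) ≤ t i + 1 / 2 := fun i => Nat.floor_le (by
    linarith [htm i, (Nat.cast_nonneg m : (0 : ℝ) ≤ m)])
  have hk2 : ∀ i, t i - 1 / 2 < k i := fun i => by
    have := Nat.lt_floor_add_one (t i + 1 / 2)
    simp only [hk]; linarith
  have hdiff : ∀ i j : ℕ, i < j → t i + 2 ≤ t j := by
    intro i j hij
    have hc : (i : ℝ) + 1 ≤ j := by exact_mod_cast hij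
    have : t i * θ + 2 * θ ≤ t j * θ := by
      rw [htθ, htθ]
      nlinarith
    nlinarith
  have hsign : ∀ i < n, 0 < d (k i) * (-1) ^ (j₀ + i) := by
    intro i hi
    have hkm : m ≤ k i := by
      have : (m : ℝ) < k i := by linarith [hk2 i, htm i]
      exact_mod_cast this.le
    have hkK : (k i : ℝ) ≤ K := by
      refine (hk1 i).trans (le_trans ?_ hK)
      have hc : (i : ℝ) + 1 ≤ n := by exact_mod_cast hi
      have h1 : t i ≤ m + 1 + (i + 1) * (Real.pi / θ) := by
        simp only [ht]
        rw [div_le_iff₀ hθ]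
        have : (m + 1 + (i + 1) * (Real.pi / θ)) * θ = (m + 1) * θ + (i + 1) * Real.pi := by
          field_simp
        rw [this]; linarith
      have h2 : ((i : ℝ) + 1) * (Real.pi / θ) ≤ n * (Real.pi / θ) := by gcongr
      linarith
    have h1 := hd (k i) hkm hkK
    set δ := k i * θ + φ - (j₀ + i) * Real.pi with hδ
    have hδ1 : |δ| ≤ Real.pi / 4 := by
      have : δ = (k i - t i) * θ := by rw [sub_mul, htθ]; ring
      rw [this, abs_mul, abs_of_pos hθ]
      have h5 : |(k i : ℝ) - t i| ≤ 1 / 2 := abs_le.mpr ⟨by linarith [hk2 i], by linarith [hk1 i]⟩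
      nlinarith [abs_nonneg ((k i : ℝ) - t i)]
    have hcos : 1 / 2 < Real.cos δ := by
      rw [← Real.cos_abs, ← Real.cos_pi_div_three]
      exact Real.cos_lt_cos_of_nonneg_of_le_pi (abs_nonneg _) (by linarith) (by linarith)
    have hcos2 : Real.cos δ = (-1) ^ (j₀ + i) * Real.cos (k i * θ + φ) := by
      rw [← Real.cos_sub_int_mul_pi]
      push_cast
      rfl
    have hP : 0 < M * r ^ (k i) := by positivity
    set P := M * r ^ (k i)
    rcases Int.even_or_odd (j₀ + i) with he | ho
    · rw [he.neg_one_zpow, one_mul] at hcos2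
      rw [he.neg_one_zpow, mul_one, ← hcos2] at *
      have := (abs_le.mp h1).1
      nlinarith
    · rw [ho.neg_one_zpow] at hcos2 ⊢
      have h6 : Real.cos (k i * θ + φ) = - Real.cos δ := by linarith
      rw [h6] at h1
      have := (abs_le.mp h1).2
      nlinarith
  refine ⟨k, fun _ _ => trivial, fun i j hij hj => ?_, fun i hi => ?_⟩
  · have : (k i : ℝ) < k j := by linarith [hk1 i, hk2 j, hdiff i j hij]
    exact_mod_cast this
  · have h1 := hsign i (by omega)
    have h2 := hsign (i + 1) hi
    push_cast at h2
    rw [← add_assoc, zpow_add_one₀ (by norm_num)] at h2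
    have h3 := mul_pos h1 h2
    have h4 : ((-1 : ℝ) ^ (j₀ + i)) * ((-1 : ℝ) ^ (j₀ + i)) = 1 := by
      rw [← mul_zpow]; norm_num
    have h5 : d (k i) * (-1) ^ (j₀ + i) * (d (k (i + 1)) * ((-1) ^ (j₀ + i) * -1)) =
      - (d (k i) * d (k (i + 1))) * (((-1 : ℝ) ^ (j₀ + i)) * ((-1 : ℝ) ^ (j₀ + i))) := by ring
    rw [h5, h4] at h3
    linarith

theorem HasAlternatingChain.mono {α : Type*} [Preorder α] {f : α → ℝ} {s : Set α} {m n : ℕ}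
    (h : HasAlternatingChain f s n) (hmn : m ≤ n) : HasAlternatingChain f s m := by
  obtain ⟨x, hx, hmono, halt⟩ := h
  exact ⟨x, fun i hi => hx i (hi.trans_le hmn), fun i j hij hj => hmono i j hij (hj.trans_le hmn),
    fun i hi => halt i (hi.trans_le hmn)⟩

theorem HasAlternatingChain.pos_mul {α : Type*} [Preorder α] {f g : α → ℝ} {s : Set α} {n : ℕ}
    (h : HasAlternatingChain f s n) (hg : ∀ x, 0 < g x) :
    HasAlternatingChain (fun x => g x * f x) s n := by
  obtain ⟨x, hx, hmono, halt⟩ := h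
  refine ⟨x, hx, hmono, fun i hi => ?_⟩
  have h1 := mul_neg_of_pos_of_neg (mul_pos (hg (x i)) (hg (x (i + 1)))) (halt i hi)
  linarith

theorem exists_prod_log_sub_log_eq_mul {x : ℝ} (hx : 0 < x) (l : List ℝ) (hl : ∀ b ∈ l, 0 < b) :
    ∃ κ > 0, (l.map (Real.log x - Real.log ·)).prod = κ * (l.map (x - ·)).prod := by
  induction l with
  | nil => exact ⟨1, one_pos, by simp⟩
  | cons b l ih =>
    obtain ⟨κ, hκ, h⟩ := ih fun b' hb' => hl b' (List.mem_cons_of_mem _ hb')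
    have hb : 0 < b := hl b List.mem_cons_self
    have : ∃ μ > 0, Real.log x - Real.log b = μ * (x - b) := by
      rcases lt_trichotomy x b with hxb | rfl | hxb
      · refine ⟨(Real.log x - Real.log b) / (x - b), div_pos_of_neg_of_neg ?_ ?_, ?_⟩
        · linarith [Real.log_lt_log hx hxb]
        · linarith
        · rw [div_mul_cancel₀ _ (by linarith : x - b ≠ 0)]
      · exact ⟨1, one_pos, by simp⟩
      · refine ⟨(Real.log x - Real.log b) / (x - b), div_pos ?_ ?_, ?_⟩
        · linarith [Real.log_lt_log hb hxb]
        · linarith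
        · rw [div_mul_cancel₀ _ (by linarith : x - b ≠ 0)]
    obtain ⟨μ, hμ, h'⟩ := this
    refine ⟨μ * κ, mul_pos hμ hκ, ?_⟩
    simp only [List.map_cons, List.prod_cons, h, h']
    ring

open MeasureTheory in
/-- Sign changes of the logarithmic moments of `f * u`, with `u` positive, force sign changes
of `f`. -/
theorem HasAlternatingChain.of_log_moments {f u : ℝ → ℝ} {T : ℝ} {n : ℕ}
    (hu : ∀ x ∈ Set.Ioc 1 T, 0 < u x)
    (hint : ∀ k : ℕ, IntegrableOn (fun x => f x * u x * Real.log x ^ k) (Set.Ioc 1 T))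
    (h : HasAlternatingChain (fun k : ℕ => ∫ x in Set.Ioc 1 T, f x * u x * Real.log x ^ k)
      Set.univ (n + 2)) :
    HasAlternatingChain f (Set.Ioc 1 T) (n + 1) := by
  by_contra hcon
  obtain ⟨l, hln, hlb, hpos⟩ := exists_list_prod_sub_mul_nonneg f 1 n 1 (Set.Ioc 1 T) T
    subset_rfl (by
      rintro ⟨x, hx, hmono, halt, -⟩
      exact hcon ⟨x, fun i hi => hx i (Nat.lt_succ_iff.mp hi),
        fun i j hij hj => hmono i j hij (Nat.lt_succ_iff.mp hj), fun i hi => halt i (by omega)⟩)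
  refine not_hasAlternatingChain_moments (μ := volume.restrict (Set.Ioc 1 T)) (L := Real.log)
    ?_ (l.map Real.log) ?_ (fun x => f x * u x) hint ?_ (h.mono (by simpa using hln))
  · filter_upwards [ae_restrict_mem measurableSet_Ioc] with x hx
    exact Real.log_nonneg hx.1.le
  · intro b hb
    obtain ⟨b', hb', rfl⟩ := List.mem_map.mp hb
    exact Real.log_pos (hlb b' hb').1
  · filter_upwards [ae_restrict_mem measurableSet_Ioc] with x hx
    obtain ⟨κ, hκ, hprod⟩ := exists_prod_log_sub_log_eq_mul (one_pos.trans hx.1) l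
      fun b hb => one_pos.trans (hlb b hb).1
    have h1 := hpos x hx
    have h2 := mul_nonneg (mul_pos (hu x hx) hκ).le h1
    rw [List.map_map]
    change 0 ≤ f x * u x * (l.map (Real.log x - Real.log ·)).prod
    rw [hprod]
    linarith

open MeasureTheory Set Filter Topology ComplexConjugate

/-- The entire function `(s - 1) * ζ s`. -/
noncomputable def zetaMulSubOne : ℂ → ℂ :=
  Function.update (fun s => (s - 1) * riemannZeta s) 1 1

theorem zetaMulSubOne_of_ne {s : ℂ} (hs : s ≠ 1) :
    zetaMulSubOne s = (s - 1) * riemannZeta s :=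
  Function.update_of_ne hs _ _

theorem zetaMulSubOne_eventuallyEq {s : ℂ} (hs : s ≠ 1) :
    zetaMulSubOne =ᶠ[𝓝 s] fun s => (s - 1) * riemannZeta s := by
  filter_upwards [isOpen_ne.mem_nhds hs] with z hz using zetaMulSubOne_of_ne hz

theorem differentiable_zetaMulSubOne : Differentiable ℂ zetaMulSubOne := by
  have hcont : ContinuousAt zetaMulSubOne 1 :=
    continuousAt_update_same.mpr riemannZeta_residue_one
  have h := (Complex.differentiableOn_compl_singleton_and_continuousAt_iff
    (f := zetaMulSubOne) (c := 1) (s := Set.univ) univ_mem).mp ⟨fun s hs => ?_, hcont⟩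
  · exact differentiableOn_univ.mp h
  · have hs1 : s ≠ 1 := hs.2
    refine DifferentiableAt.differentiableWithinAt ?_
    refine DifferentiableAt.congr_of_eventuallyEq ?_ (zetaMulSubOne_eventuallyEq hs1)
    exact (differentiableAt_id.sub_const 1).mul (differentiableAt_riemannZeta hs1)

theorem zetaMulSubOne_ne_zero_of_one_le_re {s : ℂ} (hs : 1 ≤ s.re) : zetaMulSubOne s ≠ 0 := by
  rcases eq_or_ne s 1 with rfl | hs1
  · simp [zetaMulSubOne]
  · rw [zetaMulSubOne_of_ne hs1]
    exact mul_ne_zero (sub_ne_zero.mpr hs1) (riemannZeta_ne_zero_of_one_le_re hs)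

theorem zetaMulSubOne_eq_zero_iff {s : ℂ} (hs : 0 < s.re) :
    zetaMulSubOne s = 0 ↔ riemannZeta s = 0 ∧ s.re < 1 := by
  rcases lt_or_ge s.re 1 with h | h
  · have hs1 : s ≠ 1 := by rintro rfl; simp at h
    simp [zetaMulSubOne_of_ne hs1, sub_ne_zero.mpr hs1, h]
  · simp [zetaMulSubOne_ne_zero_of_one_le_re h, not_lt.mpr h]

theorem integrableOn_mul_cpow_of_norm_le {A : ℝ → ℂ} (hA : Measurable A) {C : ℝ}
    (hC : ∀ t, 1 < t → ‖A t‖ ≤ C * t) {s : ℂ} (hs : 1 < s.re) :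
    IntegrableOn (fun t : ℝ => A t * (t : ℂ) ^ (-(s + 1))) (Ioi 1) := by
  have hint : IntegrableOn (fun t : ℝ => C * t ^ (-s.re)) (Ioi 1) :=
    (integrableOn_Ioi_rpow_of_lt (by linarith) one_pos).const_mul C
  refine Integrable.mono' hint ?_ ?_
  · refine (hA.aestronglyMeasurable.mul ?_)
    exact (by fun_prop : Measurable fun t : ℝ => (t : ℂ) ^ (-(s + 1))).aestronglyMeasurable
  · filter_upwards [ae_restrict_mem measurableSet_Ioi] with t ht
    have ht0 : 0 < t := one_pos.trans ht
    rw [norm_mul, Complex.norm_cpow_eq_rpow_re_of_pos ht0]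
    calc ‖A t‖ * t ^ (-(s + 1)).re ≤ C * t * t ^ (-(s + 1)).re := by
          gcongr; exact hC t ht
      _ = C * t ^ (-s.re) := by
          rw [mul_assoc]
          congr 1
          nth_rewrite 1 [← Real.rpow_one t]
          rw [← Real.rpow_add ht0]
          congr 1
          simp

theorem integral_mul_cpow_neg_add_one {s : ℂ} (hs : 1 < s.re) :
    ∫ t in Ioi (1 : ℝ), (t : ℂ) * (t : ℂ) ^ (-(s + 1)) = 1 / (s - 1) := by
  have h1 : ∫ t in Ioi (1 : ℝ), (t : ℂ) * (t : ℂ) ^ (-(s + 1)) =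
      ∫ t in Ioi (1 : ℝ), (t : ℂ) ^ (-s) := by
    refine setIntegral_congr_fun measurableSet_Ioi fun t ht => ?_
    have ht0 : (t : ℂ) ≠ 0 := by exact_mod_cast (one_pos.trans ht).ne'
    nth_rewrite 1 [← Complex.cpow_one (t : ℂ)]
    rw [← Complex.cpow_add _ _ ht0]
    congr 1
    ring
  rw [h1, integral_Ioi_cpow_of_lt (by simpa using hs) one_pos]
  have : s - 1 ≠ 0 := fun h => by
    rw [sub_eq_zero.mp h] at hs; simp at hs
  have h2 : -s + 1 ≠ 0 := fun h => this (by linear_combination -h)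
  simp only [Complex.ofReal_one, Complex.one_cpow]
  field_simp
  ring

theorem riemannZeta_eq_mul_integral_floor {s : ℂ} (hs : 1 < s.re) :
    riemannZeta s = s * ∫ t in Ioi (1 : ℝ), ((⌊t⌋₊ : ℕ) : ℂ) * (t : ℂ) ^ (-(s + 1)) := by
  rw [← LSeries_one_eq_riemannZeta hs,
    LSeries_eq_mul_integral 1 zero_le_one hs (LSeriesSummable_one_iff.mpr hs)]
  · simp
  · refine Asymptotics.isBigO_of_le _ fun n => ?_
    simp

theorem mellin_fract_eq {s : ℂ} (hs : 1 < s.re) :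
    mellin ((Ioi 1).indicator fun t : ℝ => ((Int.fract t : ℝ) : ℂ)) (-s) =
      1 / (s - 1) - riemannZeta s / s := by
  have hs0 : s ≠ 0 := by rintro rfl; simp at hs; linarith
  have hfl : Measurable fun t : ℝ => ((⌊t⌋₊ : ℕ) : ℂ) :=
    measurable_from_nat.comp Nat.measurable_floor
  have h1 : riemannZeta s / s = ∫ t in Ioi (1 : ℝ), ((⌊t⌋₊ : ℕ) : ℂ) * (t : ℂ) ^ (-(s + 1)) := by
    rw [riemannZeta_eq_mul_integral_floor hs]; field_simp
  rw [h1, ← integral_mul_cpow_neg_add_one hs, ← integral_sub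
    (integrableOn_mul_cpow_of_norm_le (by fun_prop) (C := 1) (fun t ht => ?_) hs)
    (integrableOn_mul_cpow_of_norm_le hfl (C := 1) (fun t ht => ?_) hs), mellin]
  · have : (fun t : ℝ => (t : ℂ) ^ (-s - 1) •
        (Ioi 1).indicator (fun t : ℝ => ((Int.fract t : ℝ) : ℂ)) t) =
        (Ioi 1).indicator fun t : ℝ => (t : ℂ) ^ (-s - 1) * ((Int.fract t : ℝ) : ℂ) := by
      ext t
      by_cases ht : t ∈ Ioi (1 : ℝ) <;> simp [ht]
    rw [this, setIntegral_indicator measurableSet_Ioi,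
      Set.inter_eq_right.mpr (Ioi_subset_Ioi zero_le_one)]
    refine setIntegral_congr_fun measurableSet_Ioi fun t ht => ?_
    have ht0 : 0 ≤ t := (one_pos.trans ht).le
    have : Int.fract t = t - (⌊t⌋₊ : ℕ) := by
      rw [Int.fract, natCast_floor_eq_intCast_floor ht0]
    simp only [this]
    push_cast
    rw [show -s - 1 = -(s + 1) by ring]
    ring
  · have ht0 : 0 < t := one_pos.trans ht
    simp [abs_of_pos ht0]
  · have ht0 : 0 < t := one_pos.trans ht
    simpa using Nat.floor_le ht0.le

theorem differentiableAt_mellin_fract {s : ℂ} (hs : s.re < 0) :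
    DifferentiableAt ℂ (mellin ((Ioi 1).indicator fun t : ℝ => ((Int.fract t : ℝ) : ℂ))) s := by
  have hb : ∀ t : ℝ, ‖(Ioi 1).indicator (fun t : ℝ => ((Int.fract t : ℝ) : ℂ)) t‖ ≤ 1 := by
    intro t
    by_cases ht : t ∈ Ioi (1 : ℝ)
    · simp only [ht, indicator_of_mem, Complex.norm_real, Real.norm_eq_abs, Int.abs_fract]
      exact (Int.fract_lt_one t).le
    · simp [ht]
  have hm : Measurable ((Ioi 1).indicator fun t : ℝ => ((Int.fract t : ℝ) : ℂ)) :=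
    (Complex.measurable_ofReal.comp measurable_fract).indicator measurableSet_Ioi
  refine mellin_differentiableAt_of_isBigO_rpow (a := 0) (b := s.re - 1) ?_ ?_ hs ?_ (by linarith)
  · refine LocallyIntegrable.locallyIntegrableOn ?_ _
    exact (locallyIntegrable_const (1 : ℝ)).mono hm.aestronglyMeasurable
      (ae_of_all _ fun t => by simpa using hb t)
  · refine Asymptotics.isBigO_of_le _ fun t => ?_
    simpa using hb t
  · refine Asymptotics.IsBigO.congr' (Asymptotics.isBigO_zero _ _) ?_ EventuallyEq.rfl
    filter_upwards [mem_nhdsWithin_of_mem_nhds (Iio_mem_nhds (zero_lt_one' ℝ))] with t ht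
    simp [not_lt.mpr (le_of_lt (mem_Iio.mp ht))]

theorem zetaMulSubOne_eq_mellin_fract {s : ℂ} (hs : 0 < s.re) :
    zetaMulSubOne s = s - s * (s - 1) *
      mellin ((Ioi 1).indicator fun t : ℝ => ((Int.fract t : ℝ) : ℂ)) (-s) := by
  have hopen : IsOpen {s : ℂ | 0 < s.re} := isOpen_lt continuous_const Complex.continuous_re
  have hconn : IsPreconnected {s : ℂ | 0 < s.re} := (convex_halfSpace_re_gt 0).isPreconnected
  refine AnalyticOnNhd.eqOn_of_preconnected_of_eventuallyEq (f := zetaMulSubOne)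
    (g := fun s => s - s * (s - 1) *
      mellin ((Ioi 1).indicator fun t : ℝ => ((Int.fract t : ℝ) : ℂ)) (-s))
    (differentiable_zetaMulSubOne.differentiableOn.analyticOnNhd hopen)
    (DifferentiableOn.analyticOnNhd (fun z hz => ?_) hopen) hconn
    (z₀ := 2) (by simp) ?_ hs
  · have hz' : (-z).re < 0 := by simpa using hz
    have h2 : DifferentiableAt ℂ (fun z : ℂ => mellin ((Ioi 1).indicator
        fun t : ℝ => ((Int.fract t : ℝ) : ℂ)) (-z)) z :=
      (differentiableAt_mellin_fract hz').comp z differentiableAt_id.neg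
    exact (differentiableAt_id.sub ((differentiableAt_id.mul (differentiableAt_id.sub_const 1)).mul
      h2)).differentiableWithinAt
  · have : {s : ℂ | 1 < s.re} ∈ 𝓝 (2 : ℂ) :=
      (isOpen_lt continuous_const Complex.continuous_re).mem_nhds (by simp)
    filter_upwards [this] with z hz
    have hz0 : z ≠ 0 := by rintro rfl; simp at hz; linarith
    have hz1 : z ≠ 1 := by rintro rfl; simp at hz
    rw [mellin_fract_eq hz, zetaMulSubOne_of_ne hz1]
    have := sub_ne_zero.mpr hz1
    field_simp
    ring

/-- The Riemann zeta function has no zeros in the real interval `(0, 1)`. -/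
theorem riemannZeta_ofReal_ne_zero {x : ℝ} (h0 : 0 < x) (h1 : x < 1) :
    riemannZeta (x : ℂ) ≠ 0 := by
  intro hz
  have hne : (x : ℂ) ≠ 1 := by exact_mod_cast h1.ne
  have h := zetaMulSubOne_eq_mellin_fract (s := (x : ℂ)) (by simpa using h0)
  rw [zetaMulSubOne_of_ne hne, hz, mul_zero, mellin] at h
  have hreal : ∫ t in Ioi (0 : ℝ), (t : ℂ) ^ (-(x : ℂ) - 1) •
      (Ioi 1).indicator (fun t : ℝ => ((Int.fract t : ℝ) : ℂ)) t =
      ((∫ t in Ioi (0 : ℝ), t ^ (-x - 1) * (Ioi 1).indicator (fun t => Int.fract t) t : ℝ) : ℂ) := by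
    rw [← integral_complex_ofReal]
    refine setIntegral_congr_fun measurableSet_Ioi fun t ht => ?_
    have : (t : ℂ) ^ (-(x : ℂ) - 1) = ((t ^ (-x - 1) : ℝ) : ℂ) := by
      rw [Complex.ofReal_cpow (le_of_lt ht)]; push_cast; rfl
    simp only [this]
    by_cases h : t ∈ Ioi (1 : ℝ) <;> simp [h]
  rw [hreal] at h
  have hnn : 0 ≤ ∫ t in Ioi (0 : ℝ), t ^ (-x - 1) * (Ioi 1).indicator (fun t => Int.fract t) t := by
    refine setIntegral_nonneg measurableSet_Ioi fun t ht => mul_nonneg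
      (Real.rpow_nonneg (le_of_lt ht) _) (indicator_nonneg (fun t _ => Int.fract_nonneg t) t)
  generalize (∫ t in Ioi (0 : ℝ), t ^ (-x - 1) * (Ioi 1).indicator (fun t => Int.fract t) t) = J
    at h hnn
  have h' : (0 : ℝ) = x - x * (x - 1) * J := by exact_mod_cast h
  have : 0 ≤ x * (1 - x) * J := mul_nonneg (mul_nonneg h0.le (by linarith)) hnn
  nlinarith

theorem chebyshevPsi_eq_psi (x : ℝ) : chebyshevPsi x = Chebyshev.psi x := rfl

theorem abs_chebyshevPsi_sub_le {x : ℝ} (hx : 0 ≤ x) : |chebyshevPsi x - x| ≤ 6 * x := by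
  have h1 := Chebyshev.psi_le_const_mul_self hx
  have h2 : 0 ≤ chebyshevPsi x := Finset.sum_nonneg fun _ _ => ArithmeticFunction.vonMangoldt_nonneg
  have h3 : Real.log 4 < 2 := by
    have : (4 : ℝ) = 2 ^ 2 := by norm_num
    rw [this, Real.log_pow]
    have := Real.log_two_lt_d9
    push_cast
    linarith
  rw [← chebyshevPsi_eq_psi] at h1
  rw [abs_le]
  constructor <;> nlinarith

theorem measurable_chebyshevPsi : Measurable chebyshevPsi :=
  (measurable_from_nat
    (f := fun n : ℕ => ∑ k ∈ Finset.Icc 1 n, ArithmeticFunction.vonMangoldt k)).comp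
    Nat.measurable_floor

theorem integral_chebyshevPsi_sub_mul_cpow {s : ℂ} (hs : 1 < s.re) :
    ∫ t in Ioi (1 : ℝ), ((chebyshevPsi t - t : ℝ) : ℂ) * (t : ℂ) ^ (-(s + 1)) =
      -(1 / s) * (1 + logDeriv zetaMulSubOne s) := by
  have hs0 : s ≠ 0 := by rintro rfl; simp at hs; linarith
  have hs1 : s ≠ 1 := by rintro rfl; simp at hs
  have hsub := sub_ne_zero.mpr hs1
  have hζ := riemannZeta_ne_zero_of_one_lt_re hs
  have hld : logDeriv zetaMulSubOne s = 1 / (s - 1) + deriv riemannZeta s / riemannZeta s := by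
    have h := logDeriv_mul (f := fun s : ℂ => s - 1) s hsub hζ (by fun_prop)
      (differentiableAt_riemannZeta hs1)
    rw [logDeriv_apply, (zetaMulSubOne_eventuallyEq hs1).deriv_eq, zetaMulSubOne_of_ne hs1]
    simpa [logDeriv_apply] using h
  have hψ : ∀ t, 1 < t → ‖(chebyshevPsi t : ℂ)‖ ≤ 7 * t := by
    intro t ht
    have := abs_chebyshevPsi_sub_le (one_pos.trans ht).le
    rw [Complex.norm_real, Real.norm_eq_abs]
    have := abs_le.mp this
    rw [abs_le]
    constructor <;> linarith
  have hL : LSeries (fun n => (ArithmeticFunction.vonMangoldt n : ℂ)) s =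
      s * ∫ t in Ioi (1 : ℝ), (chebyshevPsi t : ℂ) * (t : ℂ) ^ (-(s + 1)) := by
    rw [LSeries_eq_mul_integral_of_nonneg _ zero_le_one hs _
      fun _ => ArithmeticFunction.vonMangoldt_nonneg]
    · simp [chebyshevPsi]
    · refine Asymptotics.IsBigO.of_bound 7 (Eventually.of_forall fun n => ?_)
      have := abs_chebyshevPsi_sub_le (Nat.cast_nonneg n : (0 : ℝ) ≤ n)
      have := abs_le.mp this
      simp only [chebyshevPsi, Nat.floor_natCast] at this
      rw [Real.norm_eq_abs, Real.rpow_one, Real.norm_natCast, abs_le]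
      have := (Nat.cast_nonneg n : (0 : ℝ) ≤ n)
      constructor <;> linarith
  rw [ArithmeticFunction.LSeries_vonMangoldt_eq_deriv_riemannZeta_div hs] at hL
  have h1 : ∫ t in Ioi (1 : ℝ), ((chebyshevPsi t - t : ℝ) : ℂ) * (t : ℂ) ^ (-(s + 1)) =
      (∫ t in Ioi (1 : ℝ), (chebyshevPsi t : ℂ) * (t : ℂ) ^ (-(s + 1))) - 1 / (s - 1) := by
    rw [← integral_mul_cpow_neg_add_one hs, ← integral_sub
      (integrableOn_mul_cpow_of_norm_le (by have := measurable_chebyshevPsi; fun_prop) hψ hs)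
      (integrableOn_mul_cpow_of_norm_le (by fun_prop) (C := 1) (fun t ht => ?_) hs)]
    · refine setIntegral_congr_fun measurableSet_Ioi fun t ht => ?_
      push_cast
      ring
    · have ht0 : 0 < t := one_pos.trans ht
      simp [abs_of_pos ht0]
  have h2 : ∫ t in Ioi (1 : ℝ), (chebyshevPsi t : ℂ) * (t : ℂ) ^ (-(s + 1)) =
      -(deriv riemannZeta s / riemannZeta s) / s := by
    rw [eq_div_iff hs0, mul_comm, ← hL]; ring
  rw [h1, h2, hld]
  field_simp
  ring

theorem abs_mul_rpow_mul_log_pow_le {lam σ t : ℝ} (hlam : 0 < lam) (ht : 1 < t) (k : ℕ) :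
    |(chebyshevPsi t - t) * t ^ (-(σ + 1)) * Real.log t ^ k| ≤
      6 * k.factorial * (lam ^ k)⁻¹ * t ^ (lam - σ) := by
  have ht0 : 0 < t := one_pos.trans ht
  have hlog : 0 ≤ Real.log t := Real.log_nonneg ht.le
  have h1 := Real.pow_div_factorial_le_exp (lam * Real.log t) (by positivity) k
  have h2 : Real.exp (lam * Real.log t) = t ^ lam := by
    rw [Real.rpow_def_of_pos ht0, mul_comm]
  have hk : (0 : ℝ) < k.factorial := by exact_mod_cast k.factorial_pos
  have h3 : Real.log t ^ k ≤ k.factorial * (lam ^ k)⁻¹ * t ^ lam := by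
    rw [h2, div_le_iff₀ hk, mul_pow] at h1
    have : 0 < lam ^ k := by positivity
    calc Real.log t ^ k = (lam ^ k)⁻¹ * (lam ^ k * Real.log t ^ k) := by field_simp
      _ ≤ (lam ^ k)⁻¹ * (t ^ lam * k.factorial) := by gcongr
      _ = _ := by ring
  rw [abs_mul, abs_mul, abs_of_nonneg (Real.rpow_nonneg ht0.le _), abs_of_nonneg (pow_nonneg hlog k)]
  calc |chebyshevPsi t - t| * t ^ (-(σ + 1)) * Real.log t ^ k
      ≤ 6 * t * t ^ (-(σ + 1)) * (k.factorial * (lam ^ k)⁻¹ * t ^ lam) := by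
        gcongr
        exact abs_chebyshevPsi_sub_le ht0.le
    _ = 6 * k.factorial * (lam ^ k)⁻¹ * (t ^ (1 : ℝ) * t ^ (-(σ + 1)) * t ^ lam) := by
        rw [Real.rpow_one]; ring
    _ = _ := by
        rw [← Real.rpow_add ht0, ← Real.rpow_add ht0]
        congr 2; ring

theorem measurable_psi_mul_rpow_mul_log_pow (σ : ℝ) (k : ℕ) :
    Measurable fun t : ℝ => (chebyshevPsi t - t) * t ^ (-(σ + 1)) * Real.log t ^ k := by
  have := measurable_chebyshevPsi
  fun_prop

theorem integrableOn_psi_mul_rpow_mul_log_pow {σ : ℝ} (hσ : 1 < σ) (k : ℕ) :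
    IntegrableOn (fun t : ℝ => (chebyshevPsi t - t) * t ^ (-(σ + 1)) * Real.log t ^ k)
      (Ioi 1) := by
  have hint : IntegrableOn (fun t : ℝ =>
      6 * k.factorial * (((σ - 1) / 2) ^ k)⁻¹ * t ^ ((σ - 1) / 2 - σ)) (Ioi 1) :=
    (integrableOn_Ioi_rpow_of_lt (by linarith) one_pos).const_mul _
  refine Integrable.mono' hint (measurable_psi_mul_rpow_mul_log_pow σ k).aestronglyMeasurable ?_
  filter_upwards [ae_restrict_mem measurableSet_Ioi] with t ht
  exact abs_mul_rpow_mul_log_pow_le (by linarith) ht k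

/-- The logarithmic moments of `(ψ t - t) / t ^ (σ + 1)` on `(1, ∞)`. -/
noncomputable def psiMoment (σ : ℝ) (k : ℕ) : ℝ :=
  ∫ t in Ioi (1 : ℝ), (chebyshevPsi t - t) * t ^ (-(σ + 1)) * Real.log t ^ k

theorem abs_psiMoment_sub_integral_Ioc_le {σ lam T : ℝ} (hlam : 0 < lam) (hσ : 1 < σ - lam)
    (hT : 1 < T) (k : ℕ) :
    |psiMoment σ k - ∫ t in Ioc 1 T, (chebyshevPsi t - t) * t ^ (-(σ + 1)) * Real.log t ^ k| ≤
      6 * k.factorial * (lam ^ k)⁻¹ * (T ^ (lam - σ + 1) / (σ - lam - 1)) := by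
  have hi := integrableOn_psi_mul_rpow_mul_log_pow (σ := σ) (by linarith) k
  have hsplit : psiMoment σ k =
      (∫ t in Ioc 1 T, (chebyshevPsi t - t) * t ^ (-(σ + 1)) * Real.log t ^ k) +
      ∫ t in Ioi T, (chebyshevPsi t - t) * t ^ (-(σ + 1)) * Real.log t ^ k := by
    rw [psiMoment, ← Ioc_union_Ioi_eq_Ioi hT.le]
    exact setIntegral_union (Ioc_disjoint_Ioi le_rfl) measurableSet_Ioi
      (hi.mono_set Ioc_subset_Ioi_self) (hi.mono_set (Ioi_subset_Ioi hT.le))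
  rw [hsplit, add_sub_cancel_left]
  have hint : IntegrableOn (fun t : ℝ =>
      6 * k.factorial * (lam ^ k)⁻¹ * t ^ (lam - σ)) (Ioi T) :=
    (integrableOn_Ioi_rpow_of_lt (by linarith) (by linarith)).const_mul _
  have h := norm_integral_le_of_norm_le hint
    (f := fun t => (chebyshevPsi t - t) * t ^ (-(σ + 1)) * Real.log t ^ k) (by
      filter_upwards [ae_restrict_mem measurableSet_Ioi] with t ht
      exact abs_mul_rpow_mul_log_pow_le hlam (hT.trans ht) k)
  rw [integral_const_mul, integral_Ioi_rpow_of_lt (by linarith) (by linarith)] at h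
  refine h.trans_eq ?_
  rw [neg_div, ← div_neg, neg_add, neg_sub, sub_eq_add_neg (σ - lam)]

theorem hasSum_psiMoment {σ : ℝ} {w : ℂ} (hw : ‖w‖ < σ - 1) :
    HasSum (fun k : ℕ => ((psiMoment σ k / k.factorial : ℝ) : ℂ) * w ^ k)
      (∫ t in Ioi (1 : ℝ), ((chebyshevPsi t - t : ℝ) : ℂ) * (t : ℂ) ^ (-((σ - w) + 1))) := by
  have hσ : 1 < σ := by linarith [norm_nonneg w]
  have key : HasSum (fun k : ℕ => ∫ t in Ioi (1 : ℝ),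
      (((chebyshevPsi t - t) * t ^ (-(σ + 1)) * Real.log t ^ k : ℝ) : ℂ) *
        (w ^ k / (k.factorial : ℂ)))
      (∫ t in Ioi (1 : ℝ), ((chebyshevPsi t - t : ℝ) : ℂ) * (t : ℂ) ^ (-((σ - w) + 1))) := by
    refine hasSum_integral_of_dominated_convergence
      (bound := fun k t => 6 * t ^ (-σ) * ((‖w‖ * Real.log t) ^ k / k.factorial)) ?_ ?_ ?_ ?_ ?_
    · intro k
      exact ((Complex.measurable_ofReal.comp
        (measurable_psi_mul_rpow_mul_log_pow σ k)).mul_const _).aestronglyMeasurable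
    · intro k
      filter_upwards [ae_restrict_mem measurableSet_Ioi] with t ht
      have ht0 : 0 < t := one_pos.trans ht
      have hlog : 0 ≤ Real.log t := Real.log_nonneg (le_of_lt ht)
      rw [norm_mul, norm_div, norm_pow, Complex.norm_real, Real.norm_eq_abs, abs_mul, abs_mul,
        abs_of_nonneg (Real.rpow_nonneg ht0.le _), abs_of_nonneg (pow_nonneg hlog k),
        Complex.norm_natCast]
      calc |chebyshevPsi t - t| * t ^ (-(σ + 1)) * Real.log t ^ k * (‖w‖ ^ k / k.factorial)
          ≤ 6 * t * t ^ (-(σ + 1)) * Real.log t ^ k * (‖w‖ ^ k / k.factorial) := by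
            gcongr
            exact abs_chebyshevPsi_sub_le ht0.le
        _ = 6 * (t ^ (1 : ℝ) * t ^ (-(σ + 1))) * ((‖w‖ * Real.log t) ^ k / k.factorial) := by
            rw [Real.rpow_one, mul_pow]; ring
        _ = _ := by
            rw [← Real.rpow_add ht0]
            congr 3; ring
    · exact ae_of_all _ fun t => (Real.summable_pow_div_factorial _).mul_left _
    · have hint : IntegrableOn (fun t : ℝ => 6 * t ^ (‖w‖ - σ)) (Ioi 1) :=
        (integrableOn_Ioi_rpow_of_lt (by linarith) one_pos).const_mul _
      refine hint.congr_fun (fun t ht => ?_) measurableSet_Ioi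
      have ht0 : 0 < t := one_pos.trans ht
      have hexp : ∑' k : ℕ, (‖w‖ * Real.log t) ^ k / (k.factorial : ℝ) = t ^ ‖w‖ := by
        rw [Real.rpow_def_of_pos ht0, mul_comm, Real.exp_eq_exp_ℝ]
        exact (NormedSpace.expSeries_div_hasSum_exp _).tsum_eq
      simp only
      rw [tsum_mul_left, hexp, mul_assoc, ← Real.rpow_add ht0]
      congr 2; ring
    · filter_upwards [ae_restrict_mem measurableSet_Ioi] with t ht
      have ht0 : 0 < t := one_pos.trans ht
      have htC : (t : ℂ) ≠ 0 := by exact_mod_cast ht0.ne'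
      have hexp : HasSum (fun k : ℕ => (w * Real.log t) ^ k / (k.factorial : ℂ))
          ((t : ℂ) ^ w) := by
        rw [Complex.cpow_def_of_ne_zero htC, ← Complex.ofReal_log ht0.le, mul_comm,
          Complex.exp_eq_exp_ℂ]
        exact NormedSpace.expSeries_div_hasSum_exp _
      have h := hexp.mul_left (((chebyshevPsi t - t) * t ^ (-(σ + 1)) : ℝ) : ℂ)
      have hpow : ((t ^ (-(σ + 1)) : ℝ) : ℂ) = (t : ℂ) ^ (-((σ : ℂ) + 1)) := by
        rw [Complex.ofReal_cpow ht0.le]; push_cast; rfl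
      have hval : ((chebyshevPsi t - t : ℝ) : ℂ) * (t : ℂ) ^ (-((σ - w) + 1)) =
          (((chebyshevPsi t - t) * t ^ (-(σ + 1)) : ℝ) : ℂ) * (t : ℂ) ^ w := by
        rw [Complex.ofReal_mul, hpow, mul_assoc, ← Complex.cpow_add _ _ htC]
        congr 2; ring
      rw [hval]
      refine h.congr_fun fun k => ?_
      push_cast
      ring
  convert key using 2 with k
  rw [integral_mul_const, integral_complex_ofReal, psiMoment]
  push_cast
  ring

/-- The Taylor coefficients of a function with two simple poles near the disc. -/
theorem exists_norm_coeff_sub_le {c : ℕ → ℂ} {Φ H : ℂ → ℂ} {δ R : ℝ} (hδ : 0 < δ) (hR : 0 < R)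
    (hc : ∀ w : ℂ, ‖w‖ < δ → HasSum (fun k => c k * w ^ k) (Φ w)) (a b p q : ℂ)
    (hΦ : ∀ w : ℂ, ‖w‖ < δ → Φ w = a / (1 - p * w) + b / (1 - q * w) + H w)
    (hH : DifferentiableOn ℂ H (Metric.closedBall 0 R)) :
    ∃ C, ∀ k, ‖c k - (a * p ^ k + b * q ^ k)‖ ≤ C * R⁻¹ ^ k := by
  lift R to NNReal using hR.le
  have h1 : HasFPowerSeriesAt H (cauchyPowerSeries H 0 R) 0 :=
    (hH.hasFPowerSeriesOnBall (by exact_mod_cast hR)).hasFPowerSeriesAt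
  have hgeom : ∀ d u : ℂ, ∀ᶠ w : ℂ in 𝓝 0,
      HasSum (fun k => d * u ^ k * w ^ k) (d / (1 - u * w)) := by
    intro d u
    have : ∀ᶠ w : ℂ in 𝓝 0, ‖u * w‖ < 1 := by
      have hcont : Continuous fun w : ℂ => ‖u * w‖ := by fun_prop
      exact hcont.continuousAt.eventually_lt continuousAt_const (by simp)
    filter_upwards [this] with w hw
    have := (hasSum_geometric_of_norm_lt_one hw).mul_left d
    simpa [mul_pow, mul_assoc, div_eq_mul_inv] using this
  have h2 : HasFPowerSeriesAt H
      (FormalMultilinearSeries.ofScalars ℂ fun k => c k - (a * p ^ k + b * q ^ k)) 0 := by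
    rw [hasFPowerSeriesAt_iff]
    filter_upwards [hgeom a p, hgeom b q, Metric.ball_mem_nhds (0 : ℂ) hδ] with w ha hb hw
    have hw' : ‖w‖ < δ := by simpa using hw
    have h := (hc w hw').sub (ha.add hb)
    rw [hΦ w hw', add_sub_cancel_left] at h
    convert h using 2 with k
    · rw [FormalMultilinearSeries.coeff_ofScalars, smul_eq_mul]
      ring
    · simp
  refine ⟨(2 * Real.pi)⁻¹ * ∫ θ in 0..2 * Real.pi, ‖H (circleMap 0 R θ)‖, fun k => ?_⟩
  have h3 := norm_cauchyPowerSeries_le H 0 R k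
  rw [← h2.eq_formalMultilinearSeries h1, FormalMultilinearSeries.norm_apply_eq_norm_coef,
    FormalMultilinearSeries.coeff_ofScalars, abs_of_pos hR] at h3
  exact h3

theorem exists_entire_eq_pow_mul {f : ℂ → ℂ} (hf : Differentiable ℂ f) (hf0 : ∃ z, f z ≠ 0)
    (a : ℂ) : ∃ (n : ℕ) (g : ℂ → ℂ), Differentiable ℂ g ∧ g a ≠ 0 ∧
      ∀ z, f z = (z - a) ^ n * g z := by
  have han : AnalyticOnNhd ℂ f univ := fun z _ => hf.analyticAt z
  have hne : ¬∀ᶠ z in 𝓝 a, f z = 0 := by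
    intro h
    obtain ⟨z, hz⟩ := hf0
    exact hz (han.eqOn_zero_of_preconnected_of_eventuallyEq_zero isPreconnected_univ
      (mem_univ a) h (mem_univ z))
  obtain ⟨n, g₀, hg₀, hg₀a, hfg⟩ :=
    (hf.analyticAt a).exists_eventuallyEq_pow_smul_nonzero_iff.mpr hne
  set g : ℂ → ℂ := Function.update (fun z => f z / (z - a) ^ n) a (g₀ a) with hg
  have hga : g a = g₀ a := Function.update_self ..
  have hgne : ∀ z, z ≠ a → g z = f z / (z - a) ^ n := fun z hz => Function.update_of_ne hz ..
  have heq : g =ᶠ[𝓝 a] g₀ := by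
    filter_upwards [hfg] with z hz
    rcases eq_or_ne z a with rfl | hza
    · exact hga
    · have : (z - a) ^ n ≠ 0 := pow_ne_zero _ (sub_ne_zero.mpr hza)
      rw [hgne z hza, hz, smul_eq_mul, mul_div_cancel_left₀ _ this]
  refine ⟨n, g, fun z => ?_, hga ▸ hg₀a, fun z => ?_⟩
  · rcases eq_or_ne z a with rfl | hza
    · exact hg₀.differentiableAt.congr_of_eventuallyEq heq
    · have hpow : (z - a) ^ n ≠ 0 := pow_ne_zero _ (sub_ne_zero.mpr hza)
      have : g =ᶠ[𝓝 z] fun z => f z / (z - a) ^ n := by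
        filter_upwards [isOpen_ne.mem_nhds hza] with u hu using hgne u hu
      exact DifferentiableAt.congr_of_eventuallyEq ((hf z).div (by fun_prop) hpow) this
  · rcases eq_or_ne z a with rfl | hza
    · rw [hga, hfg.self_of_nhds, smul_eq_mul]
    · have : (z - a) ^ n ≠ 0 := pow_ne_zero _ (sub_ne_zero.mpr hza)
      rw [hgne z hza, mul_div_cancel₀ _ this]

theorem exists_zetaMulSubOne_eq_pow_mul_pow_mul {ρ : ℂ} (hρ : zetaMulSubOne ρ = 0) :
    ∃ (m n : ℕ) (g : ℂ → ℂ), m ≠ 0 ∧ Differentiable ℂ g ∧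
      g ρ ≠ 0 ∧ g (conj ρ) ≠ 0 ∧
      ∀ s, zetaMulSubOne s = (s - ρ) ^ m * ((s - conj ρ) ^ n * g s) := by
  obtain ⟨m, g₁, hg₁, hg₁ρ, h₁⟩ := exists_entire_eq_pow_mul differentiable_zetaMulSubOne
    ⟨2, zetaMulSubOne_ne_zero_of_one_le_re (by norm_num)⟩ ρ
  obtain ⟨n, g, hg, hgρ, h₂⟩ := exists_entire_eq_pow_mul hg₁ ⟨ρ, hg₁ρ⟩ (conj ρ)
  refine ⟨m, n, g, ?_, hg, ?_, hgρ, fun s => by rw [h₁, h₂]⟩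
  · rintro rfl
    rw [h₁, pow_zero, one_mul] at hρ
    exact hg₁ρ hρ
  · intro h
    rw [h₂, h, mul_zero] at hg₁ρ
    exact hg₁ρ rfl

/-- The coefficients `psiMoment σ k / k!` behave like the contribution of the nearest zeros. -/
theorem exists_abs_psiMoment_sub_le {σ R : ℝ} {ρ : ℂ} (hσ : 1 < σ) (hρ : zetaMulSubOne ρ = 0)
    (him : 0 < ρ.im) (hR : 0 < R) (hRσ : R < σ)
    (hz : ∀ z ∈ Metric.closedBall (σ : ℂ) R, zetaMulSubOne z = 0 → z = ρ ∨ z = conj ρ) :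
    ∃ A : ℂ, A ≠ 0 ∧ ∃ C, ∀ k : ℕ,
      |psiMoment σ k / k.factorial - (A * ((σ - ρ)⁻¹) ^ k).re| ≤ C * R⁻¹ ^ k := by
  obtain ⟨m, n, g, hm, hg, hgρ, hgρ', hfac⟩ := exists_zetaMulSubOne_eq_pow_mul_pow_mul hρ
  have hρ0 : ρ ≠ 0 := by rintro rfl; simp at him
  have hρ0' : conj ρ ≠ 0 := by simpa using hρ0
  have hgne : ∀ z ∈ Metric.closedBall (σ : ℂ) R, g z ≠ 0 := by
    intro z hzR h
    rcases hz z hzR (by rw [hfac, h]; simp) with rfl | rfl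
    · exact hgρ h
    · exact hgρ' h
  have hσρ : (σ : ℂ) - ρ ≠ 0 := by
    intro h
    have := congrArg Complex.im h
    simp at this
    exact him.ne' this
  have hσρ' : (σ : ℂ) - conj ρ ≠ 0 := by
    intro h
    have := congrArg Complex.im h
    simp at this
    exact him.ne' this
  set q : ℂ := ((σ : ℂ) - ρ)⁻¹ with hq
  have hqc : conj q = ((σ : ℂ) - conj ρ)⁻¹ := by simp [hq]
  have hq0 : q ≠ 0 := inv_ne_zero hσρ
  set H : ℂ → ℂ := fun w => -(1 / (σ - w)) * (1 + deriv g (σ - w) / g (σ - w)) +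
    (m / ρ + n / conj ρ) * (1 / (σ - w)) with hH
  have hHd : DifferentiableOn ℂ H (Metric.closedBall 0 R) := by
    intro w hw
    have hw' : ‖w‖ ≤ R := by simpa using hw
    have h1 : (σ : ℂ) - w ≠ 0 := by
      intro h
      rw [← sub_eq_zero.mp h, Complex.norm_real, Real.norm_eq_abs] at hw'
      linarith [le_abs_self σ]
    have h2 : g (σ - w) ≠ 0 := hgne _ (by simpa [Metric.mem_closedBall, dist_eq_norm] using hw')
    have h3 : Differentiable ℂ (deriv g) := fun z => (hg.analyticAt z).deriv.differentiableAt
    have h4 : DifferentiableAt ℂ (fun w : ℂ => (σ : ℂ) - w) w := by fun_prop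
    have h5 := (hg (σ - w)).comp w h4
    have h6 := (h3 (σ - w)).comp w h4
    have h7 := (differentiableAt_const (1 : ℂ)).div h4 h1
    exact ((h7.neg.mul ((h6.div h5 h2).const_add 1)).add
      (h7.const_mul _)).differentiableWithinAt
  have hΦ : ∀ w : ℂ, ‖w‖ < σ - 1 →
      ∫ t in Ioi (1 : ℝ), ((chebyshevPsi t - t : ℝ) : ℂ) * (t : ℂ) ^ (-((σ - w) + 1)) =
        -(m / ρ) * q / (1 - q * w) + -(n / conj ρ) * conj q / (1 - conj q * w) + H w := by
    intro w hw
    set s : ℂ := σ - w with hs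
    have hre : 1 < s.re := by
      have := (abs_le.mp (Complex.abs_re_le_norm w)).2
      simp only [hs, Complex.sub_re, Complex.ofReal_re]
      linarith
    have hs0 : s ≠ 0 := by intro h; rw [h] at hre; simp at hre; linarith
    have hZ := zetaMulSubOne_ne_zero_of_one_le_re hre.le
    rw [hfac] at hZ
    have hp := left_ne_zero_of_mul hZ
    have hp' := left_ne_zero_of_mul (right_ne_zero_of_mul hZ)
    have hgs := right_ne_zero_of_mul (right_ne_zero_of_mul hZ)
    have hsρ : s - ρ ≠ 0 := fun h => hp (by rw [h]; exact zero_pow hm)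
    have hsρ' : s - conj ρ ≠ 0 := by
      intro h
      refine zetaMulSubOne_ne_zero_of_one_le_re (s := ρ) ?_ hρ
      rw [sub_eq_zero.mp h, Complex.conj_re] at hre
      exact hre.le
    have hld : logDeriv zetaMulSubOne s = m / (s - ρ) + (n / (s - conj ρ) + deriv g s / g s) := by
      have hfun : zetaMulSubOne = fun s => (s - ρ) ^ m * ((s - conj ρ) ^ n * g s) := funext hfac
      rw [hfun, logDeriv_mul (f := fun s => (s - ρ) ^ m)
        (g := fun s => (s - conj ρ) ^ n * g s) s hp (right_ne_zero_of_mul hZ) (by fun_prop)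
        ((by fun_prop : DifferentiableAt ℂ (fun s => (s - conj ρ) ^ n) s).mul (hg s)),
        logDeriv_mul (f := fun s => (s - conj ρ) ^ n) (g := g) s hp' hgs (by fun_prop) (hg s),
        logDeriv_fun_pow (f := fun s => s - ρ) (by fun_prop),
        logDeriv_fun_pow (f := fun s => s - conj ρ) (by fun_prop)]
      simp [logDeriv_apply, div_eq_mul_inv]
    rw [integral_chebyshevPsi_sub_mul_cpow hre, hld, hH, hqc, hq]
    have e1 : -(m / ρ) * (σ - ρ)⁻¹ / (1 - (σ - ρ)⁻¹ * w) = -(m / ρ) * (1 / (s - ρ)) := by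
      have : 1 - (σ - ρ)⁻¹ * w = (s - ρ) * (σ - ρ)⁻¹ := by
        rw [hs]; field_simp; ring
      rw [this]; field_simp
    have e2 : -(n / conj ρ) * (σ - conj ρ)⁻¹ / (1 - (σ - conj ρ)⁻¹ * w) =
        -(n / conj ρ) * (1 / (s - conj ρ)) := by
      have : 1 - (σ - conj ρ)⁻¹ * w = (s - conj ρ) * (σ - conj ρ)⁻¹ := by
        rw [hs]; field_simp; ring
      rw [this]; field_simp
    rw [e1, e2]
    simp only [← hs]
    field_simp
    ring
  obtain ⟨C, hC⟩ := exists_norm_coeff_sub_le (δ := σ - 1) (R := R) (by linarith) hR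
    (c := fun k => ((psiMoment σ k / k.factorial : ℝ) : ℂ))
    (fun w hw => hasSum_psiMoment hw) (-(m / ρ) * q) (-(n / conj ρ) * conj q) q (conj q)
    (H := H) hΦ hHd
  refine ⟨-((m + n) / ρ) * q, ?_, C, fun k => ?_⟩
  · have : (m : ℂ) + n ≠ 0 := by exact_mod_cast (by omega : m + n ≠ 0)
    simp [this, hρ0, hq0]
  · refine le_trans ?_ (hC k)
    refine le_trans (le_of_eq ?_) (Complex.abs_re_le_norm _)
    congr 1
    have hconj : -(n / conj ρ) * conj q * (conj q) ^ k = conj (-(n / ρ) * q * q ^ k) := by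
      simp
    rw [Complex.sub_re, Complex.ofReal_re, Complex.add_re, hconj, Complex.conj_re,
      ← Complex.add_re]
    congr 2
    ring

theorem countable_riemannZetaZeros : riemannZetaZeros.Countable := by
  have : riemannZetaZeros = ⋃ n : ℕ, Metric.closedBall (0 : ℂ) n ∩ riemannZetaZeros := by
    rw [← iUnion_inter, Metric.iUnion_closedBall_nat, univ_inter]
  rw [this]
  exact countable_iUnion fun n =>
    ((isCompact_closedBall _ _).inter_riemannZetaZeros_finite).countable

theorem norm_ofReal_sub_sq (σ : ℝ) (z : ℂ) :
    ‖(σ : ℂ) - z‖ ^ 2 = σ ^ 2 - 2 * σ * z.re + ‖z‖ ^ 2 := by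
  rw [Complex.sq_norm, Complex.sq_norm, Complex.normSq_apply, Complex.normSq_apply]
  simp
  ring

/-- Outside a countable set of real centres, zeros of `ζ` at equal distance are conjugate. -/
theorem exists_lt_forall_zeros_equidistant (B : ℝ) : ∃ σ > B, ∀ z ∈ riemannZetaZeros,
    ∀ w ∈ riemannZetaZeros, ‖(σ : ℂ) - z‖ = ‖(σ : ℂ) - w‖ → z = w ∨ z = conj w := by
  let bad : Set ℝ := image (fun p : ℂ × ℂ => (‖p.1‖ ^ 2 - ‖p.2‖ ^ 2) / (2 * (p.1.re - p.2.re)))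
    (riemannZetaZeros ×ˢ riemannZetaZeros)
  have hc : bad.Countable :=
    (countable_riemannZetaZeros.prod countable_riemannZetaZeros).image _
  obtain ⟨σ, hσ, hBσ⟩ := (hc.dense_compl ℝ).exists_gt B
  refine ⟨σ, hBσ, fun z hz w hw h => ?_⟩
  have h2 : ‖(σ : ℂ) - z‖ ^ 2 = ‖(σ : ℂ) - w‖ ^ 2 := by rw [h]
  rw [norm_ofReal_sub_sq, norm_ofReal_sub_sq] at h2
  by_cases hre : z.re = w.re
  · rw [Complex.sq_norm, Complex.sq_norm, Complex.normSq_apply, Complex.normSq_apply, hre] at h2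
    have h3 : z.im * z.im = w.im * w.im := by linarith
    rcases mul_self_eq_mul_self_iff.mp h3 with h4 | h4
    · exact Or.inl (Complex.ext hre h4)
    · exact Or.inr (Complex.ext (by simpa using hre) (by simpa using h4))
  · refine absurd ⟨(z, w), ⟨hz, hw⟩, ?_⟩ hσ
    have : z.re - w.re ≠ 0 := sub_ne_zero.mpr hre
    simp only
    rw [div_eq_iff (by simpa using this)]
    linarith

theorem re_pos_of_norm_ofReal_sub_lt {σ : ℝ} {z : ℂ} (h : ‖(σ : ℂ) - z‖ < σ) : 0 < z.re := by
  have := (Complex.abs_re_le_norm ((σ : ℂ) - z))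
  have := (abs_le.mp this).2
  simp only [Complex.sub_re, Complex.ofReal_re] at this
  linarith

theorem exists_isolated_nearest_zero {ρ₀ : ℂ} (h0 : riemannZeta ρ₀ = 0) (hre : 0 < ρ₀.re) (B : ℝ) :
    ∃ σ R : ℝ, ∃ ρ : ℂ, B < σ ∧ R < σ ∧ ‖(σ : ℂ) - ρ‖ < R ∧ riemannZeta ρ = 0 ∧
      0 < ρ.re ∧ ρ.re < 1 ∧ 0 < ρ.im ∧
      ∀ z ∈ Metric.closedBall (σ : ℂ) R, zetaMulSubOne z = 0 → z = ρ ∨ z = conj ρ := by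
  obtain ⟨σ, hσ, hgen⟩ := exists_lt_forall_zeros_equidistant
    (max (max B 1) (‖ρ₀‖ ^ 2 / (2 * ρ₀.re)))
  have hσ1 : 1 < σ := (le_max_right _ _).trans_lt ((le_max_left _ _).trans_lt hσ)
  have hσB : B < σ := (le_max_left _ _).trans_lt ((le_max_left _ _).trans_lt hσ)
  have hρ₀σ : ‖(σ : ℂ) - ρ₀‖ < σ := by
    refine lt_of_pow_lt_pow_left₀ 2 (by linarith) ?_
    have := (le_max_right _ _).trans_lt hσ
    rw [div_lt_iff₀ (by linarith)] at this
    rw [norm_ofReal_sub_sq]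
    linarith
  have hfin : (Metric.closedBall (σ : ℂ) σ ∩ riemannZetaZeros).Finite :=
    (isCompact_closedBall _ _).inter_riemannZetaZeros_finite
  obtain ⟨ρ₁, ⟨-, hρ₁⟩, hmin⟩ := exists_min_image _ (fun z => ‖(σ : ℂ) - z‖) hfin
    ⟨ρ₀, by simpa [dist_eq_norm'] using hρ₀σ.le, h0⟩
  have hρ₁σ : ‖(σ : ℂ) - ρ₁‖ < σ :=
    (hmin ρ₀ ⟨by simpa [dist_eq_norm'] using hρ₀σ.le, h0⟩).trans_lt hρ₀σ
  have hre₁ := re_pos_of_norm_ofReal_sub_lt hρ₁σ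
  have hlt₁ : ρ₁.re < 1 := by
    by_contra! h
    exact riemannZeta_ne_zero_of_one_le_re h hρ₁
  have him₁ : ρ₁.im ≠ 0 := by
    intro h
    have : ρ₁ = (ρ₁.re : ℂ) := Complex.ext rfl (by simpa using h)
    refine riemannZeta_ofReal_ne_zero hre₁ hlt₁ ?_
    rw [← this]
    exact hρ₁
  have hiso : ∃ R, ‖(σ : ℂ) - ρ₁‖ < R ∧ R < σ ∧
      ∀ z ∈ Metric.closedBall (σ : ℂ) R, zetaMulSubOne z = 0 → z = ρ₁ ∨ z = conj ρ₁ := by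
    have hfin' := hfin.subset (t := {z | z ∈ Metric.closedBall (σ : ℂ) σ ∩ riemannZetaZeros ∧
      ¬(z = ρ₁ ∨ z = conj ρ₁)}) fun z hz => hz.1
    have hev : ∀ᶠ R in 𝓝[>] ‖(σ : ℂ) - ρ₁‖, ∀ z ∈ {z | z ∈ Metric.closedBall (σ : ℂ) σ ∩
        riemannZetaZeros ∧ ¬(z = ρ₁ ∨ z = conj ρ₁)}, R < ‖(σ : ℂ) - z‖ := by
      refine (eventually_all_finite hfin').mpr fun z hz => ?_
      refine mem_nhdsWithin_of_mem_nhds (Iio_mem_nhds ?_)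
      exact lt_of_le_of_ne (hmin z hz.1) fun h => hz.2 (hgen z hz.1.2 ρ₁ hρ₁ h.symm)
    have hev' : ∀ᶠ R in 𝓝[>] ‖(σ : ℂ) - ρ₁‖, R < σ :=
      mem_nhdsWithin_of_mem_nhds (Iio_mem_nhds hρ₁σ)
    obtain ⟨R, ⟨hR, hR1⟩, hR2⟩ := ((hev.and hev').and self_mem_nhdsWithin).exists
    refine ⟨R, hR2, hR1, fun z hz hZ => ?_⟩
    have hz' : ‖(σ : ℂ) - z‖ ≤ R := by simpa [dist_eq_norm'] using hz
    have hzre := re_pos_of_norm_ofReal_sub_lt (hz'.trans_lt hR1)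
    by_contra hne
    refine not_lt.mpr hz' (hR z ⟨⟨?_, ((zetaMulSubOne_eq_zero_iff hzre).mp hZ).1⟩, hne⟩)
    exact Metric.closedBall_subset_closedBall hR1.le hz
  obtain ⟨R, hR1, hR2, hiso⟩ := hiso
  rcases lt_or_gt_of_ne him₁ with him | him
  · refine ⟨σ, R, conj ρ₁, hσB, hR2, ?_, ?_, by simpa, by simpa, by simpa, ?_⟩
    · rwa [← Complex.norm_conj, map_sub, Complex.conj_conj, Complex.conj_ofReal]
    · rw [riemannZeta_conj, mem_riemannZetaZeros.mp hρ₁, map_zero]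
    · intro z hz hZ
      rw [Complex.conj_conj]
      exact (hiso z hz hZ).symm
  · exact ⟨σ, R, ρ₁, hσB, hR2, hR1, hρ₁, hre₁, hlt₁, him, hiso⟩

theorem exists_chebyshevPsi_chain_of_log_moments {σ T : ℝ} (hσ : 1 < σ) {n : ℕ}
    (h : HasAlternatingChain (fun k : ℕ => ∫ t in Ioc 1 T,
      (chebyshevPsi t - t) * t ^ (-(σ + 1)) * Real.log t ^ k) univ (n + 2)) :
    HasAlternatingChain (fun x => chebyshevPsi x - x) (Icc 2 T) n := by
  obtain ⟨x, hx, hmono, halt⟩ := HasAlternatingChain.of_log_moments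
    (f := fun x => chebyshevPsi x - x) (u := fun t => t ^ (-(σ + 1)))
    (fun x hx => Real.rpow_pos_of_pos (one_pos.trans hx.1) _)
    (fun k => (integrableOn_psi_mul_rpow_mul_log_pow hσ k).mono_set Ioc_subset_Ioi_self) h
  have hneg : ∀ y, 1 < y → y < 2 → chebyshevPsi y - y < 0 := by
    intro y h1 h2
    have : ⌊y⌋₊ = 1 := (Nat.floor_eq_iff (by linarith)).mpr ⟨by simpa using h1.le, by
      norm_num; exact h2⟩
    rw [chebyshevPsi, this]
    simp
    linarith
  refine ⟨fun i => x (i + 1), fun i hi => ⟨?_, (hx (i + 1) (by omega)).2⟩,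
    fun i j hij hj => hmono _ _ (by omega) (by omega), fun i hi => halt (i + 1) (by omega)⟩
  by_contra! hlt
  have h1 := hx i (by omega)
  have h2 := hmono i (i + 1) (by omega) (by omega)
  have h3 := halt i (by omega)
  have h4 := mul_pos_of_neg_of_neg (hneg _ h1.1 (h2.trans hlt)) (hneg _ (h1.1.trans h2) hlt)
  linarith

theorem re_mul_pow_eq_mul_cos (A q : ℂ) (k : ℕ) :
    (A * q ^ k).re = ‖A‖ * ‖q‖ ^ k * Real.cos (k * q.arg + A.arg) := by
  conv_lhs => rw [← Complex.norm_mul_exp_arg_mul_I A, ← Complex.norm_mul_exp_arg_mul_I q]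
  have : (‖A‖ : ℂ) * Complex.exp (A.arg * Complex.I) *
      (‖q‖ * Complex.exp (q.arg * Complex.I)) ^ k =
      ((‖A‖ * ‖q‖ ^ k : ℝ) : ℂ) * Complex.exp (((k * q.arg + A.arg : ℝ) : ℂ) * Complex.I) := by
    rw [mul_pow, ← Complex.exp_nat_mul]
    push_cast
    rw [add_mul, Complex.exp_add]
    ring_nf
  rw [this, Complex.re_ofReal_mul, Complex.exp_ofReal_mul_I_re]

/-- The truncation error of the moments is small compared with `σ ^ (-k)` for
`k ≤ (1 - 2 * e) * σ * log T`. -/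
theorem inv_pow_mul_rpow_le {σ e T : ℝ} (he : 0 < e) (he2 : e < 1 / 2) (hσ : 2 / e ^ 2 ≤ σ)
    (hT : 1 < T) {k : ℕ} (hk : (k : ℝ) ≤ (1 - 2 * e) * σ * Real.log T) :
    ((σ * (1 - e)) ^ k)⁻¹ * T ^ (1 - σ * e) ≤ (σ ^ k)⁻¹ * T⁻¹ := by
  have hT0 : 0 < T := one_pos.trans hT
  have hlog : 0 < Real.log T := Real.log_pos hT
  have hσ0 : 0 < σ := lt_of_lt_of_le (by positivity) hσ
  have hσe : 2 ≤ σ * e ^ 2 := by rwa [div_le_iff₀ (by positivity)] at hσ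
  have h1e : 0 < 1 - e := by linarith
  have hkey : ((1 - e) ^ k)⁻¹ ≤ T ^ (σ * (e - e ^ 2)) := by
    have h1 : Real.log (1 - e)⁻¹ ≤ e / (1 - e) := by
      refine (Real.log_le_sub_one_of_pos (by positivity)).trans_eq ?_
      field_simp
      ring
    rw [← inv_pow, ← Real.exp_log (by positivity : 0 < (1 - e)⁻¹), ← Real.exp_nat_mul,
      Real.rpow_def_of_pos hT0]
    refine Real.exp_le_exp.mpr ?_
    calc k * Real.log (1 - e)⁻¹ ≤ k * (e / (1 - e)) := by gcongr
      _ ≤ ((1 - e) ^ 2 * σ * Real.log T) * (e / (1 - e)) := by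
          gcongr
          refine hk.trans ?_
          gcongr
          nlinarith
      _ = Real.log T * (σ * (e - e ^ 2)) := by
          field_simp
  calc ((σ * (1 - e)) ^ k)⁻¹ * T ^ (1 - σ * e)
      = (σ ^ k)⁻¹ * (((1 - e) ^ k)⁻¹ * T ^ (1 - σ * e)) := by
        rw [mul_pow, mul_inv]; ring
    _ ≤ (σ ^ k)⁻¹ * (T ^ (σ * (e - e ^ 2)) * T ^ (1 - σ * e)) := by gcongr
    _ = (σ ^ k)⁻¹ * T ^ (1 - σ * e ^ 2) := by
        rw [← Real.rpow_add hT0]; congr 2; ring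
    _ ≤ (σ ^ k)⁻¹ * T ^ (-1 : ℝ) := by
        gcongr
        · exact hT.le
        · linarith
    _ = _ := by rw [Real.rpow_neg_one]

theorem exists_log_moments_chain {γ e : ℝ} (hγ : 0 < γ) (hγ' : ∀ t ∈ zetaOrdinates, γ ≤ t)
    (hne : zetaOrdinates.Nonempty) (he : 0 < e) (he2 : e < 1 / 2) :
    ∃ σ : ℝ, 1 < σ ∧ ∃ C T₀ : ℝ, ∀ T ≥ T₀, ∀ n : ℕ,
      (n : ℝ) ≤ (1 - 2 * e) * γ / Real.pi * Real.log T - C →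
      HasAlternatingChain (fun k : ℕ => ∫ t in Ioc 1 T,
        (chebyshevPsi t - t) * t ^ (-(σ + 1)) * Real.log t ^ k) univ n := by
  obtain ⟨t₀, ht₀, ρ₀, hρ₀, hre₀, -, -⟩ := hne
  obtain ⟨σ, R, ρ, hσ, hRσ, hρR, hρ, hre, hre1, him, hiso⟩ :=
    exists_isolated_nearest_zero hρ₀ hre₀ (max 1 (2 / e ^ 2))
  have hσ1 : 1 < σ := (le_max_left _ _).trans_lt hσ
  have hσe : 2 / e ^ 2 ≤ σ := ((le_max_right _ _).trans_lt hσ).le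
  have hσe' : 2 ≤ σ * e ^ 2 := by rwa [div_le_iff₀ (by positivity)] at hσe
  have hσe1 : 1 < σ * e := by nlinarith
  have hpi := Real.pi_pos
  have hR : 0 < R := (norm_nonneg _).trans_lt hρR
  obtain ⟨A, hA, C, hC⟩ := exists_abs_psiMoment_sub_le hσ1
    ((zetaMulSubOne_eq_zero_iff hre).mpr ⟨hρ, hre1⟩) him hR hRσ hiso
  have hγρ : γ ≤ ρ.im := hγ' _ ⟨him, ρ, hρ, hre, hre1, rfl⟩
  have hσρ : (σ : ℂ) - ρ ≠ 0 := by
    intro h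
    have := congrArg Complex.im h
    simp at this
    exact him.ne' this
  set q : ℂ := ((σ : ℂ) - ρ)⁻¹ with hq
  have hq0 : q ≠ 0 := inv_ne_zero hσρ
  have hqnorm : ‖q‖ = ‖(σ : ℂ) - ρ‖⁻¹ := norm_inv _
  have hr0 : 0 < ‖q‖ := norm_pos_iff.mpr hq0
  have hM : 0 < ‖A‖ := norm_pos_iff.mpr hA
  have hdpos : 0 < ‖(σ : ℂ) - ρ‖ := norm_pos_iff.mpr hσρ
  have hnsq : 0 < Complex.normSq ((σ : ℂ) - ρ) := Complex.normSq_pos.mpr hσρ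
  have hqre : 0 < q.re := by
    rw [hq, Complex.inv_re]
    refine div_pos ?_ hnsq
    simp only [Complex.sub_re, Complex.ofReal_re]
    linarith
  have hqim : q.im = ρ.im / Complex.normSq ((σ : ℂ) - ρ) := by
    rw [hq, Complex.inv_im]; simp
  have hqim0 : 0 < q.im := by rw [hqim]; positivity
  have hθ2 : q.arg ≤ Real.pi / 2 :=
    (abs_le.mp (Complex.abs_arg_le_pi_div_two_iff.mpr hqre.le)).2
  have hθ0 : 0 ≤ q.arg := Complex.arg_nonneg_iff.mpr hqim0.le
  have hθγ : γ / σ ≤ q.arg := by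
    refine le_trans ?_ (Real.sin_le hθ0)
    rw [Complex.sin_arg, hqim, hqnorm, Complex.normSq_eq_norm_sq]
    have : ρ.im / ‖(σ : ℂ) - ρ‖ ^ 2 / ‖(σ : ℂ) - ρ‖⁻¹ = ρ.im / ‖(σ : ℂ) - ρ‖ := by
      field_simp
    rw [this]
    gcongr
    exact (hρR.trans hRσ).le
  have hθpos : 0 < q.arg := lt_of_lt_of_le (by positivity) hθγ
  have hgeo : Tendsto (fun k : ℕ => C * (R⁻¹ / ‖q‖) ^ k) atTop (𝓝 0) := by
    rw [← mul_zero C]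
    refine (tendsto_pow_atTop_nhds_zero_of_lt_one (by positivity) ?_).const_mul C
    rw [hqnorm, div_lt_one (by positivity)]
    gcongr
  obtain ⟨m, hm⟩ := eventually_atTop.mp (hgeo.eventually_lt_const (by positivity : 0 < ‖A‖ / 4))
  refine ⟨σ, hσ1, (m + 2) * (γ / (σ * Real.pi)), max 2 (24 / ((σ * e - 1) * ‖A‖)),
    fun T hT n hn => ?_⟩
  have hT1 : 1 < T := by linarith [(le_max_left _ _).trans hT]
  have hT0 : 0 < T := one_pos.trans hT1
  have hT2 : 6 / (σ * e - 1) * T⁻¹ ≤ ‖A‖ / 4 := by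
    have := (le_max_right _ _).trans hT
    have h1 : 0 < σ * e - 1 := by linarith
    rw [div_le_iff₀ (by positivity)] at this
    rw [div_mul_eq_mul_div, div_le_iff₀ h1, ← div_eq_mul_inv, div_le_iff₀ hT0]
    linarith
  have hchain : HasAlternatingChain (fun k : ℕ => (∫ t in Ioc 1 T,
      (chebyshevPsi t - t) * t ^ (-(σ + 1)) * Real.log t ^ k) / k.factorial) univ n := by
    refine hasAlternatingChain_of_near_cos (m := m) (K := (1 - 2 * e) * σ * Real.log T)
      (φ := A.arg) hM hr0 hθpos hθ2 ?_ fun k hmk hkK => ?_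
    · have h1 : n * (Real.pi / q.arg) ≤ n * (Real.pi / (γ / σ)) := by gcongr
      have h2 : n * (Real.pi / (γ / σ)) ≤ ((1 - 2 * e) * γ / Real.pi * Real.log T -
          (m + 2) * (γ / (σ * Real.pi))) * (Real.pi / (γ / σ)) := by gcongr
      have h3 : ((1 - 2 * e) * γ / Real.pi * Real.log T -
          (m + 2) * (γ / (σ * Real.pi))) * (Real.pi / (γ / σ)) =
          (1 - 2 * e) * σ * Real.log T - (m + 2) := by
        field_simp
      linarith
    · have hkfac : (0 : ℝ) < k.factorial := by exact_mod_cast k.factorial_pos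
      have h1 := hC k
      rw [re_mul_pow_eq_mul_cos] at h1
      have h2 := abs_psiMoment_sub_integral_Ioc_le (σ := σ) (lam := σ * (1 - e)) (T := T)
        (by nlinarith) (by linarith) hT1 k
      have h3 := inv_pow_mul_rpow_le he he2 hσe hT1 hkK
      have hrk : 0 < ‖q‖ ^ k := by positivity
      have h4 : C * R⁻¹ ^ k ≤ ‖A‖ / 4 * ‖q‖ ^ k := by
        have := (hm k hmk).le
        rwa [div_pow, ← mul_div_assoc, div_le_iff₀ hrk] at this
      have h5 : (σ ^ k)⁻¹ ≤ ‖q‖ ^ k := by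
        rw [hqnorm, ← inv_pow]
        gcongr
        exact (hρR.trans hRσ).le
      set I := ∫ t in Ioc 1 T, (chebyshevPsi t - t) * t ^ (-(σ + 1)) * Real.log t ^ k
      have h6 : |psiMoment σ k / k.factorial - I / k.factorial| ≤ ‖A‖ / 4 * ‖q‖ ^ k := by
        rw [← sub_div, abs_div, abs_of_pos hkfac, div_le_iff₀ hkfac]
        refine h2.trans ?_
        have e1 : σ * (1 - e) - σ + 1 = 1 - σ * e := by ring
        have e2 : σ - σ * (1 - e) - 1 = σ * e - 1 := by ring
        rw [e1, e2]
        have h1' : 0 < σ * e - 1 := by linarith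
        calc 6 * k.factorial * ((σ * (1 - e)) ^ k)⁻¹ * (T ^ (1 - σ * e) / (σ * e - 1))
            = 6 * k.factorial / (σ * e - 1) *
                (((σ * (1 - e)) ^ k)⁻¹ * T ^ (1 - σ * e)) := by ring
          _ ≤ 6 * k.factorial / (σ * e - 1) * (‖q‖ ^ k * T⁻¹) := by
              refine mul_le_mul_of_nonneg_left (h3.trans ?_) (by positivity)
              gcongr
          _ = 6 / (σ * e - 1) * T⁻¹ * ‖q‖ ^ k * k.factorial := by ring
          _ ≤ ‖A‖ / 4 * ‖q‖ ^ k * k.factorial := by gcongr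
      rw [abs_sub_comm] at h6
      have h7 := abs_sub_le (I / k.factorial) (psiMoment σ k / k.factorial)
        (‖A‖ * ‖q‖ ^ k * Real.cos (k * q.arg + A.arg))
      linarith
  convert hchain.pos_mul (g := fun k : ℕ => (k.factorial : ℝ))
    (fun k => by exact_mod_cast k.factorial_pos) using 2 with k
  have : (k.factorial : ℝ) ≠ 0 := by exact_mod_cast k.factorial_ne_zero
  field_simp

/-- Kaczorowski's lower bound on sign changes of `ψ(x) − x`: with `γ₁ = inf` of the
ordinates of `ζ`, for every `ε > 0` and all sufficiently large `T` there are at least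
`(γ₁/π − ε) log T` points `2 ≤ x₁ < ⋯ < x_N ≤ T` at which `ψ(x) − x` alternates in sign;
that is, `liminf W^ψ(T)/log T ≥ γ₁/π`. -/
theorem sign_changes_psi_kaczorowski :
    ∀ ε : ℝ, 0 < ε → ∃ T₀ : ℝ, ∀ T : ℝ, T₀ ≤ T →
      ∃ (N : ℕ) (x : ℕ → ℝ),
        (sInf zetaOrdinates / Real.pi - ε) * Real.log T ≤ (N : ℝ) ∧
        (∀ i < N, 2 ≤ x i ∧ x i ≤ T) ∧
        (∀ i j, i < j → j < N → x i < x j) ∧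
        (∀ i, i + 1 < N →
          (chebyshevPsi (x i) - x i) * (chebyshevPsi (x (i + 1)) - x (i + 1)) < 0) := by
  intro ε hε
  have hpi := Real.pi_pos
  rcases le_or_gt (sInf zetaOrdinates) 0 with hγ | hγ
  · refine ⟨1, fun T hT => ⟨0, fun _ => 0, ?_, by simp, by simp, by simp⟩⟩
    have h1 := Real.log_nonneg hT
    have h2 : sInf zetaOrdinates / Real.pi ≤ 0 := div_nonpos_of_nonpos_of_nonneg hγ hpi.le
    simpa using mul_nonpos_of_nonpos_of_nonneg (by linarith) h1
  · set γ := sInf zetaOrdinates with hγdef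
    have hne : zetaOrdinates.Nonempty := by
      by_contra h
      rw [not_nonempty_iff_eq_empty] at h
      rw [hγdef, h, Real.sInf_empty] at hγ
      exact lt_irrefl _ hγ
    have hlb : ∀ t ∈ zetaOrdinates, γ ≤ t := fun t ht =>
      csInf_le ⟨0, fun t ht => ht.1.le⟩ ht
    obtain ⟨e, he, he2, heε⟩ : ∃ e : ℝ, 0 < e ∧ e < 1 / 2 ∧ 2 * e * γ / Real.pi ≤ ε / 2 := by
      refine ⟨min (1 / 4) (ε * Real.pi / (4 * γ)), by positivity,
        (min_le_left _ _).trans_lt (by norm_num), ?_⟩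
      have := min_le_right (1 / 4) (ε * Real.pi / (4 * γ))
      rw [le_div_iff₀ (by positivity)] at this
      rw [div_le_iff₀ hpi]
      linarith
    obtain ⟨σ, hσ, C, T₀, hchain⟩ := exists_log_moments_chain hγ hlb hne he he2
    refine ⟨max T₀ (Real.exp (max 0 (2 * (C + 3) / ε))), fun T hT => ?_⟩
    have hTexp : Real.exp (max 0 (2 * (C + 3) / ε)) ≤ T := (le_max_right _ _).trans hT
    have hT0 : 0 < T := (Real.exp_pos _).trans_le hTexp
    have hlog := (Real.le_log_iff_exp_le hT0).mpr hTexp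
    have hlog0 : 0 ≤ Real.log T := (le_max_left _ _).trans hlog
    have hlogC : C + 3 ≤ ε / 2 * Real.log T := by
      have := (le_max_right _ _).trans hlog
      rw [div_le_iff₀ hε] at this
      linarith
    set y := (1 - 2 * e) * γ / Real.pi * Real.log T - C with hy
    have hbound : (γ / Real.pi - ε) * Real.log T ≤ y - 3 := by
      have h1 : 2 * e * γ / Real.pi * Real.log T ≤ ε / 2 * Real.log T := by gcongr
      have h2 : y = γ / Real.pi * Real.log T - 2 * e * γ / Real.pi * Real.log T - C := by
        rw [hy]; ring
      linarith
    rcases lt_or_ge y 2 with hy2 | hy2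
    · exact ⟨0, fun _ => 0, by push_cast; linarith, by simp, by simp, by simp⟩
    · have hfloor : 2 ≤ ⌊y⌋₊ := Nat.le_floor (by exact_mod_cast hy2)
      obtain ⟨N, hN⟩ := Nat.exists_eq_add_of_le' hfloor
      obtain ⟨x, hx, hmono, halt⟩ := exists_chebyshevPsi_chain_of_log_moments hσ
        (hchain T ((le_max_left _ _).trans hT) (N + 2)
          (hN ▸ Nat.floor_le (by linarith : (0 : ℝ) ≤ y)))
      refine ⟨N, x, ?_, hx, hmono, halt⟩
      have h1 := Nat.lt_floor_add_one y
      rw [hN] at h1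
      push_cast at h1
      linarith
end
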